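/- arXiv:2512.22835 — 3 statements merged into one kernel-verified Lean document; each statement's English description precedes it below -/
import Mathlib

section
/- Let k > ℓ ≥ 1 with 2(k+ℓ−5) ≥ λ, let p = (k+ℓ)m+2+λ be prime with m ≥ 5 and 0 ≤ λ ≤ k+ℓ−3, and let n ≥ 1. Suppose A ⊆ F_p^n is a (k,ℓ)-sum-free set with |A| ≥ m·p^{n−1}. Then for every decomposition (v,K) of F_p^n, either ω(A) ≤ m+2 or ω(A) > p − θ, where θ = k+ℓ+λ+2. -/
open Pointwise

/-- `itSum h A` is the `h`-fold sumset `hA = A + ⋯ + A` (`h` copies), with `itSum 0 A = {0}`. -/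
def itSum {G : Type*} [AddCommMonoid G] : ℕ → Set G → Set G
  | 0, _ => {0}
  | h + 1, A => itSum h A + A

/-- `A` is `(k,ℓ)`-sum-free: the sumsets `kA` and `ℓA` are disjoint. -/
def KLFree {G : Type*} [AddCommMonoid G] (k l : ℕ) (A : Set G) : Prop :=
  itSum k A ∩ itSum l A = ∅

/-- The interval `[a, a+t] = {a, a+1, …, a+t}` in `ZMod p`. -/
def Ival {p : ℕ} (a : ZMod p) (t : ℕ) : Set (ZMod p) :=
  {x | ∃ i : ℕ, i ≤ t ∧ x = a + (i : ZMod p)}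

/-- The cuboid `[a, a+t] × F_p^{n'}` inside the model space `F_p × F_p^{n'}`. -/
def cub (p n' : ℕ) (a : ZMod p) (t : ℕ) : Set (ZMod p × (Fin n' → ZMod p)) :=
  {x | x.1 ∈ Ival a t}

/-- The element `a_j = -(km+1+j)·(k-ℓ)⁻¹` of `F_p`. -/
def ajElt (k l m p j : ℕ) : ZMod p :=
  -((k * m + 1 + j : ℕ) : ZMod p) * (((k - l : ℕ) : ZMod p))⁻¹

/-- The layer `A_i = (A - i·v) ∩ K` of `A` w.r.t. the decomposition `(v, K)`. -/
def layerKL {p n : ℕ} (v : Fin n → ZMod p) (K : Submodule (ZMod p) (Fin n → ZMod p))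
    (A : Set (Fin n → ZMod p)) (i : ZMod p) : Set (Fin n → ZMod p) :=
  {x | x ∈ K ∧ x + i • v ∈ A}

/-- The support `Supp(A) = {i | A_i ≠ ∅}` w.r.t. the decomposition `(v, K)`. -/
def supp {p n : ℕ} (v : Fin n → ZMod p) (K : Submodule (ZMod p) (Fin n → ZMod p))
    (A : Set (Fin n → ZMod p)) : Set (ZMod p) :=
  {i | (layerKL v K A i).Nonempty}

/-- The weight `ω(A) = |Supp(A)|` w.r.t. the decomposition `(v, K)`. -/
noncomputable def weight {p n : ℕ} (v : Fin n → ZMod p)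
    (K : Submodule (ZMod p) (Fin n → ZMod p)) (A : Set (Fin n → ZMod p)) : ℕ :=
  (supp v K A).ncard

/-- `A ⊆ F_p^n` is trivial: isomorphic to a subset of some extremal cuboid `A_{k,ℓ,p,j}`. -/
def IsTrivialKL (k l m lam p n : ℕ) (A : Set (Fin n → ZMod p)) : Prop :=
  ∃ (e : (Fin n → ZMod p) ≃+ (ZMod p × (Fin (n - 1) → ZMod p))) (j : ℕ),
    j < (lam + 2) / 2 ∧ e '' A ⊆ cub p (n - 1) (ajElt k l m p j) m

/-- Type 1. -/
def IsType1 (k l m lam p n : ℕ) (A : Set (Fin n → ZMod p)) : Prop :=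
  A.ncard = m * p ^ (n - 1) ∧
  ∃ (e : (Fin n → ZMod p) ≃+ (ZMod p × (Fin (n - 1) → ZMod p))) (a : ZMod p),
    ((l : ZMod p) * a - (k : ZMod p) * (a + (m : ZMod p) - 1) ∈ Ival (1 : ZMod p) (l - 1) ∨
      (lam + l + 2 ≤ k ∧
        (l : ZMod p) * a - (k : ZMod p) * (a + (m : ZMod p) - 1) ∈
          Ival ((lam + l + 2 : ℕ) : ZMod p) (k - (lam + l + 2)))) ∧
    e '' A = cub p (n - 1) a (m - 1)

/-- The element `a = m·k·(ℓ-k)⁻¹` of `F_p` used in type 2. -/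
def type2a (k l m p : ℕ) : ZMod p :=
  (m : ZMod p) * (k : ZMod p) * (((l : ZMod p) - (k : ZMod p))⁻¹)

/-- Type 2. -/
def IsType2 (k l m p n : ℕ) (A : Set (Fin n → ZMod p)) : Prop :=
  l = 1 ∧ 2 ≤ n ∧ A.ncard = m * p ^ (n - 1) ∧
  ∃ (e : (Fin n → ZMod p) ≃+ (ZMod p × (Fin (n - 1) → ZMod p)))
      (V : Submodule (ZMod p) (Fin (n - 1) → ZMod p)),
    V ≠ ⊤ ∧
    e '' A =
      ({type2a k l m p} ×ˢ (Set.univ \ (V : Set (Fin (n - 1) → ZMod p)))) ∪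
        ((Ival (type2a k l m p + 1) (m - 2)) ×ˢ (Set.univ : Set (Fin (n - 1) → ZMod p))) ∪
        ({type2a k l m p + (m : ZMod p)} ×ˢ (V : Set (Fin (n - 1) → ZMod p)))

/-- Normal: of type 1 or type 2. -/
def IsNormalKL (k l m lam p n : ℕ) (A : Set (Fin n → ZMod p)) : Prop :=
  IsType1 k l m lam p n A ∨ IsType2 k l m p n A

/-- The element `a = (ℓm+k-1)·(k-ℓ)⁻¹` of `F_p` used in type 3. -/
def type3a (k l m p : ℕ) : ZMod p :=
  ((l * m + k - 1 : ℕ) : ZMod p) * (((k - l : ℕ) : ZMod p))⁻¹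

/-- Type 3. -/
def IsType3 (k l m p n : ℕ) (A : Set (Fin n → ZMod p)) : Prop :=
  A.ncard = m * p ^ (n - 1) ∧
  ∃ e : (Fin n → ZMod p) ≃+ (ZMod p × (Fin (n - 1) → ZMod p)),
    e '' A = {x | x.1 ∈ Ival (type3a k l m p - 1) (m + 1) \
      {type3a k l m p, type3a k l m p + (m : ZMod p) - 1}}

/-- Type 4 (for `p = 5m+3`). -/
def IsType4 (m p n : ℕ) (A : Set (Fin n → ZMod p)) : Prop :=
  2 ≤ n ∧ A.ncard = m * p ^ (n - 1) ∧
  ∃ (e : (Fin n → ZMod p) ≃+ (ZMod p × (Fin (n - 1) → ZMod p)))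
      (V : Submodule (ZMod p) (Fin (n - 1) → ZMod p)),
    V ≠ ⊤ ∧
    e '' A =
      (({((2 * m + 1 : ℕ) : ZMod p), ((3 * m + 2 : ℕ) : ZMod p)} : Set (ZMod p)) ×ˢ
          (V : Set (Fin (n - 1) → ZMod p))) ∪
        (({((2 * m + 2 : ℕ) : ZMod p), ((3 * m + 1 : ℕ) : ZMod p)} : Set (ZMod p)) ×ˢ
          (Set.univ \ (V : Set (Fin (n - 1) → ZMod p)))) ∪
        ((Ival ((2 * m + 3 : ℕ) : ZMod p) (m - 3)) ×ˢ (Set.univ : Set (Fin (n - 1) → ZMod p)))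

/-- The set `A₀ ⊆ F_p × F_p^s` used in type 5 (for `p = 4m+3`), with `a = (m+2)/2`. -/
def type5A0 (m p s : ℕ) (P : Set (Fin s → ZMod p)) : Set (ZMod p × (Fin s → ZMod p)) :=
  {(((m + 2 : ℕ) : ZMod p) * (2 : ZMod p)⁻¹ - 1, (0 : Fin s → ZMod p))} ∪
    ({((m + 2 : ℕ) : ZMod p) * (2 : ZMod p)⁻¹} ×ˢ (Set.univ \ P)) ∪
    ((Ival (((m + 2 : ℕ) : ZMod p) * (2 : ZMod p)⁻¹ + 1) (m - 3)) ×ˢ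
      (Set.univ : Set (Fin s → ZMod p))) ∪
    ({((m + 2 : ℕ) : ZMod p) * (2 : ZMod p)⁻¹ + (m : ZMod p) - 1} ×ˢ
      (Set.univ \ {(0 : Fin s → ZMod p)})) ∪
    ({((m + 2 : ℕ) : ZMod p) * (2 : ZMod p)⁻¹ + (m : ZMod p)} ×ˢ P)

/-- Type 5 (for `p = 4m+3`). -/
def IsType5 (m p n : ℕ) (A : Set (Fin n → ZMod p)) : Prop :=
  A.ncard = m * p ^ (n - 1) ∧
  ∃ s : ℕ, s ≤ n - 1 ∧
    ∃ (e : (Fin n → ZMod p) ≃+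
          (ZMod p × (Fin s → ZMod p) × (Fin (n - 1 - s) → ZMod p)))
      (P : Set (Fin s → ZMod p)),
      P.Nonempty ∧ (0 : Fin s → ZMod p) ∉ itSum 3 P ∧
      e '' A = {x | (x.1, x.2.1) ∈ type5A0 m p s P}

/-- `τ` is feasible for `c`. -/
def Feasible (c τ : ℝ) : Prop :=
  ∀ q : ℕ, q.Prime → ∀ B : Set (ZMod q),
    (B.ncard : ℝ) ≤ c * q →
    ((B + B).ncard : ℝ) ≤ (2 + τ) * (B.ncard : ℝ) - 3 →
    ∃ y d : ZMod q, d ≠ 0 ∧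
      B ⊆ {x | ∃ i : ℕ, i ≤ (B + B).ncard - B.ncard ∧ x = y + (i : ZMod q) * d}

/-- If every proper subgroup of a finite abelian group has at most `D` elements, then
`|X + Y| ≥ min(|G|, |X| + |Y| - D)`. -/
theorem min_card_le_card_add_of_addSubgroup {G : Type*} [AddCommGroup G] [Fintype G]
    [DecidableEq G] {D : ℕ} (hD : ∀ H : AddSubgroup G, H ≠ ⊤ → Nat.card H ≤ D)
    (X Y : Finset G) (hX : X.Nonempty) (hY : Y.Nonempty) :
    min (Fintype.card G) (X.card + Y.card - D) ≤ (X + Y).card := by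
  induction hn : Y.card using Nat.strong_induction_on generalizing X Y with
  | _ n ih =>
  subst hn
  by_cases h : ∃ x ∈ X, ∃ y ∈ Y, ¬ ∀ z ∈ Y, z + (x - y) ∈ X
  · obtain ⟨x, hx, y, hy, hne⟩ := h
    push Not at hne
    obtain ⟨z, hz, hzX⟩ := hne
    set T := Y.image (· + (x - y)) with hT
    set Y' := Y.filter (fun u => u + (x - y) ∈ X) with hY'
    have hTcard : T.card = Y.card := Finset.card_image_of_injective _ (add_left_injective _)
    have hinter : (X ∩ T).card = Y'.card := by
      rw [← Finset.card_image_of_injective Y' (add_left_injective (x - y))]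
      congr 1
      ext u
      simp only [hT, hY', Finset.mem_inter, Finset.mem_image, Finset.mem_filter]
      constructor
      · rintro ⟨h1, w, hw, rfl⟩
        exact ⟨w, ⟨hw, h1⟩, rfl⟩
      · rintro ⟨w, ⟨hw, h1⟩, rfl⟩
        exact ⟨h1, w, hw, rfl⟩
    have hlt : Y'.card < Y.card :=
      Finset.card_lt_card (Finset.filter_ssubset.2 ⟨z, hz, hzX⟩)
    have key := ih _ hlt (X ∪ T) Y' (hX.mono Finset.subset_union_left)
      ⟨y, by simp [hY', hy, hx]⟩ rfl
    have hsub : (X ∪ T) + Y' ⊆ X + Y := by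
      intro u hu
      obtain ⟨b, hb, c, hc, rfl⟩ := Finset.mem_add.1 hu
      rw [hY', Finset.mem_filter] at hc
      rcases Finset.mem_union.1 hb with hb | hb
      · exact Finset.add_mem_add hb hc.1
      · obtain ⟨w, hw, rfl⟩ := Finset.mem_image.1 hb
        have : w + (x - y) + c = (c + (x - y)) + w := by abel
        rw [this]
        exact Finset.add_mem_add hc.2 hw
    have h1 := Finset.card_le_card hsub
    have h2 := Finset.card_union_add_card_inter X T
    have h3 : (X ∪ T).card + Y'.card = X.card + Y.card := by omega
    rw [h3] at key
    exact key.trans h1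
  · push Not at h
    obtain ⟨y₀, hy₀⟩ := hY
    let H : AddSubgroup G := AddAction.stabilizer G (X : Set G)
    have hmem : ∀ y ∈ Y, y - y₀ ∈ H := by
      intro y hy
      have hsub : X.image (· + (y - y₀)) ⊆ X := by
        intro u hu
        obtain ⟨x, hx, rfl⟩ := Finset.mem_image.1 hu
        have := h x hx y₀ hy₀ y hy
        have e : x + (y - y₀) = y + (x - y₀) := by abel
        rwa [e]
      have heq := Finset.eq_of_subset_of_card_le hsub
        (Finset.card_image_of_injective _ (add_left_injective _)).ge
      rw [AddAction.mem_stabilizer_iff]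
      conv_rhs => rw [← heq]
      ext u
      simp only [Set.mem_vadd_set, Finset.coe_image, Set.mem_image, vadd_eq_add, add_comm]
    have hYcard : Y.card ≤ Nat.card H := by
      rw [← Finset.card_image_of_injective Y (sub_left_injective (b := y₀)),
        ← Nat.card_eq_finsetCard]
      exact Nat.card_mono (Set.toFinite (H : Set G)) (by
        intro u hu
        obtain ⟨y, hy, rfl⟩ := Finset.mem_image.1 (Finset.mem_coe.1 hu)
        exact hmem y hy)
    have hXle : X.card ≤ (X + Y).card := Finset.card_le_card_add_right ⟨y₀, hy₀⟩
    by_cases hH : H = ⊤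
    · obtain ⟨x, hx⟩ := hX
      have : X = Finset.univ := by
        rw [Finset.eq_univ_iff_forall]
        intro u
        have hu : u - x ∈ H := hH ▸ AddSubgroup.mem_top _
        have hu' : (u - x) +ᵥ (X : Set G) = X := hu
        rw [← Finset.mem_coe, ← hu']
        exact Set.mem_vadd_set.2 ⟨x, hx, by simp⟩
      have hc : X.card = Fintype.card G := by rw [this, Finset.card_univ]
      rw [hc] at hXle
      exact (min_le_left _ _).trans hXle
    · have := hD H hH
      omega

theorem Finset.sum_range_nonempty {G : Type*} [AddCommGroup G] [DecidableEq G]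
    (X : ℕ → Finset G) (q : ℕ) (hX : ∀ r < q, (X r).Nonempty) :
    (∑ r ∈ Finset.range q, X r).Nonempty := by
  induction q with
  | zero => exact ⟨0, by simp⟩
  | succ q ih =>
    rw [Finset.sum_range_succ]
    exact (ih fun r hr => hX r (by omega)).add (hX q (by omega))

theorem min_card_le_card_sum_range {G : Type*} [AddCommGroup G] [Fintype G] [DecidableEq G]
    {D : ℕ} (hD : ∀ H : AddSubgroup G, H ≠ ⊤ → Nat.card H ≤ D)
    (X : ℕ → Finset G) (q : ℕ) (hX : ∀ r < q + 1, (X r).Nonempty) :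
    min (Fintype.card G) (∑ r ∈ Finset.range (q + 1), (X r).card - q * D) ≤
      (∑ r ∈ Finset.range (q + 1), X r).card := by
  induction q with
  | zero => simp
  | succ q ih =>
    have h1 := ih fun r hr => hX r (by omega)
    rw [Finset.sum_range_succ _ (q + 1), Finset.sum_range_succ _ (q + 1)]
    have hne := Finset.sum_range_nonempty X (q + 1) fun r hr => hX r (by omega)
    have hlast := hX (q + 1) (by omega)
    have h2 := min_card_le_card_add_of_addSubgroup hD _ _ hne hlast
    have h3 : (∑ r ∈ Finset.range (q + 1), X r).card ≤
        (∑ r ∈ Finset.range (q + 1), X r + X (q + 1)).card :=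
      Finset.card_le_card_add_right hlast
    have h4 : (q + 1) * D = q * D + D := by ring
    omega

theorem Finset.card_add_card_le_of_add_ne_univ {G : Type*} [AddCommGroup G] [Fintype G]
    [DecidableEq G] {X Y : Finset G} (h : X + Y ≠ Finset.univ) :
    X.card + Y.card ≤ Fintype.card G := by
  obtain ⟨z, hz⟩ : ∃ z, z ∉ X + Y := by
    by_contra! hc
    exact h (Finset.eq_univ_iff_forall.2 hc)
  have hinj : Function.Injective (fun y : G => z - y) := sub_right_injective
  have hdisj : Disjoint X (Y.image (z - ·)) := by
    rw [Finset.disjoint_left]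
    intro x hx hx'
    obtain ⟨y, hy, rfl⟩ := Finset.mem_image.1 hx'
    exact hz (Finset.mem_add.2 ⟨_, hx, y, hy, by simp⟩)
  rw [← Finset.card_image_of_injective Y hinj, ← Finset.card_union_of_disjoint hdisj]
  exact Finset.card_le_univ _

theorem sum_card_le_of_sum_ne_univ {G : Type*} [AddCommGroup G] [Fintype G] [DecidableEq G]
    {D : ℕ} (hD : ∀ H : AddSubgroup G, H ≠ ⊤ → Nat.card H ≤ D)
    (X : ℕ → Finset G) (q : ℕ) (hX : ∀ r < q + 2, (X r).Nonempty)
    (hne : ∑ r ∈ Finset.range (q + 2), X r ≠ Finset.univ) :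
    ∑ r ∈ Finset.range (q + 2), (X r).card ≤ Fintype.card G + q * D := by
  have h1 := min_card_le_card_sum_range hD X q fun r hr => hX r (by omega)
  rw [Finset.sum_range_succ] at hne ⊢
  have h2 := Finset.card_add_card_le_of_add_ne_univ hne
  have h3 := (hX (q + 1) (by omega)).card_pos
  omega

theorem card_add_card_le_of_sum_ne_univ {G : Type*} [AddCommGroup G] [Fintype G] [DecidableEq G]
    (X : ℕ → Finset G) (q : ℕ) (hX : ∀ r < q + 2, (X r).Nonempty)
    (hne : ∑ r ∈ Finset.range (q + 2), X r ≠ Finset.univ) :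
    (X 0).card + (X 1).card ≤ Fintype.card G := by
  apply Finset.card_add_card_le_of_add_ne_univ
  intro h
  apply hne
  rw [add_comm q 2, Finset.sum_range_add]
  simp only [Finset.sum_range_succ, Finset.sum_range_zero, zero_add, h]
  obtain ⟨z, hz⟩ := Finset.sum_range_nonempty (fun r => X (2 + r)) q fun r hr => hX _ (by omega)
  rw [Finset.eq_univ_iff_forall]
  intro u
  exact Finset.mem_add.2 ⟨u - z, Finset.mem_univ _, z, hz, by simp⟩

theorem Finset.exists_of_mem_sum_range {G : Type*} [AddCommGroup G] [DecidableEq G]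
    (X : ℕ → Finset G) (q : ℕ) {u : G} (hu : u ∈ ∑ r ∈ Finset.range q, X r) :
    ∃ z : ℕ → G, (∀ r < q, z r ∈ X r) ∧ ∑ r ∈ Finset.range q, z r = u := by
  induction q generalizing u with
  | zero => exact ⟨0, by simp, by simpa [eq_comm] using hu⟩
  | succ q ih =>
    rw [Finset.sum_range_succ] at hu
    obtain ⟨b, hb, c, hc, rfl⟩ := Finset.mem_add.1 hu
    obtain ⟨z, hz, rfl⟩ := ih hb
    refine ⟨fun r => if r < q then z r else c, fun r hr => ?_, ?_⟩
    · by_cases h : r < q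
      · simp [h, hz r h]
      · obtain rfl : r = q := by omega
        simp [hc]
    · rw [Finset.sum_range_succ]
      simp only [lt_irrefl, if_false]
      congr 1
      exact Finset.sum_congr rfl fun r hr => by simp [Finset.mem_range.1 hr]

/-- If no sum of elements of the first `k` sets equals a sum of elements of the last `l` sets,
then the sets are small. -/
theorem card_le_of_forall_sum_ne {G : Type*} [AddCommGroup G] [Fintype G] [DecidableEq G]
    {D : ℕ} (hD : ∀ H : AddSubgroup G, H ≠ ⊤ → Nat.card H ≤ D)
    (k l : ℕ) (hkl : 2 ≤ k + l) (X : ℕ → Finset G) (hX : ∀ r < k + l, (X r).Nonempty)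
    (hfree : ∀ z : ℕ → G, (∀ r < k + l, z r ∈ X r) →
      ∑ r ∈ Finset.range k, z r ≠ ∑ r ∈ Finset.range l, z (k + r)) :
    ∑ r ∈ Finset.range (k + l), (X r).card ≤ Fintype.card G + (k + l - 2) * D ∧
      (X 0).card + (X 1).card ≤ Fintype.card G := by
  let Y : ℕ → Finset G := fun r => if r < k then X r else -X r
  have hYcard : ∀ r, (Y r).card = (X r).card := by
    intro r
    by_cases h : r < k <;> simp [Y, h]
  have hYne : ∀ r < k + l, (Y r).Nonempty := by
    intro r hr
    rw [← Finset.card_pos, hYcard, Finset.card_pos]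
    exact hX r hr
  have hne : ∑ r ∈ Finset.range (k + l), Y r ≠ Finset.univ := by
    intro h
    obtain ⟨y, hy, hy0⟩ := Finset.exists_of_mem_sum_range Y (k + l) (u := 0)
      (h ▸ Finset.mem_univ _)
    refine hfree (fun r => if r < k then y r else -y r) (fun r hr => ?_) ?_
    · have := hy r hr
      by_cases h : r < k <;> simpa [Y, h] using this
    · rw [Finset.sum_range_add] at hy0
      have e1 : ∑ r ∈ Finset.range k, (if r < k then y r else -y r) =
          ∑ r ∈ Finset.range k, y r :=
        Finset.sum_congr rfl fun r hr => by simp [Finset.mem_range.1 hr]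
      simp only [e1, Nat.not_lt.2 (Nat.le_add_right k _), if_false, Finset.sum_neg_distrib]
      exact eq_neg_of_add_eq_zero_left hy0
  obtain ⟨q, hq⟩ : ∃ q, k + l = q + 2 := ⟨k + l - 2, by omega⟩
  rw [hq] at hYne hne ⊢
  have h1 := sum_card_le_of_sum_ne_univ hD Y q hYne hne
  have h2 := card_add_card_le_of_sum_ne_univ Y q hYne hne
  simp only [hYcard] at h1 h2
  exact ⟨h1, h2⟩

theorem sum_range_mem_itSum {G : Type*} [AddCommMonoid G] {A : Set G} (z : ℕ → G) (q : ℕ)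
    (hz : ∀ r < q, z r ∈ A) : ∑ r ∈ Finset.range q, z r ∈ itSum q A := by
  induction q with
  | zero => simp [itSum]
  | succ q ih =>
    rw [Finset.sum_range_succ]
    exact Set.add_mem_add (ih fun r hr => hz r (by omega)) (hz q (by omega))

/-- The sum of `F` over the levels `s`, `s'`, then `d` copies of `a`, then copies of `1`,
`h` levels in all. -/
theorem sum_range_levels (F : ℕ → ℤ) (h d s s' a : ℕ) (hd : d + 2 ≤ h) :
    ∑ r ∈ Finset.range h,
      F (if r = 0 then s else if r = 1 then s' else if r < d + 2 then a else 1) =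
      F s + F s' + d * F a + ((h : ℤ) - d - 2) * F 1 := by
  obtain ⟨e, rfl⟩ : ∃ e, h = 2 + d + e := ⟨h - (d + 2), by omega⟩
  rw [Finset.sum_range_add, Finset.sum_range_add]
  simp only [Finset.sum_range_succ, Finset.sum_range_zero, zero_add]
  have e1 : ∀ r ∈ Finset.range d, F (if 2 + r = 0 then s else if 2 + r = 1 then s' else
      if 2 + r < d + 2 then a else 1) = F a := by
    intro r hr
    have := Finset.mem_range.1 hr
    rw [if_neg (by omega), if_neg (by omega), if_pos (by omega)]
  have e2 : ∀ r ∈ Finset.range e, F (if 2 + d + r = 0 then s else if 2 + d + r = 1 then s' else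
      if 2 + d + r < d + 2 then a else 1) = F 1 := by
    intro r hr
    rw [if_neg (by omega), if_neg (by omega), if_neg (by omega)]
  rw [Finset.sum_congr rfl e1, Finset.sum_congr rfl e2]
  simp only [Finset.sum_const, Finset.card_range, nsmul_eq_mul, ↓reduceIte, one_ne_zero]
  push_cast
  ring

theorem sum_Icc_reflect (f : ℕ → ℤ) (b a : ℕ) :
    ∑ s ∈ Finset.Icc (b + 1) a, f (a + b + 1 - s) = ∑ s ∈ Finset.Icc (b + 1) a, f s := by
  refine Finset.sum_nbij' (fun s => a + b + 1 - s) (fun s => a + b + 1 - s) ?_ ?_ ?_ ?_ ?_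
  all_goals intro s hs; simp only [Finset.mem_Icc] at hs ⊢
  all_goals omega

theorem two_mul_sum_Icc_le {f : ℕ → ℤ} {a b : ℕ} {W C : ℤ} (hba : b ≤ a)
    (hW : ∀ s, 1 ≤ s → s ≤ b → f s ≤ W)
    (hC : ∀ s, b < s → s ≤ a → f s + f (a + b + 1 - s) ≤ C) :
    2 * ∑ s ∈ Finset.Icc 1 a, f s ≤ 2 * (b * W) + ((a : ℤ) - b) * C := by
  have hsplit : ∑ s ∈ Finset.Icc 1 a, f s =
      ∑ s ∈ Finset.Icc 1 b, f s + ∑ s ∈ Finset.Icc (b + 1) a, f s := by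
    rw [← Finset.sum_union]
    · congr 1
      ext s
      simp only [Finset.mem_union, Finset.mem_Icc]
      omega
    · rw [Finset.disjoint_left]
      intro s
      simp only [Finset.mem_Icc]
      omega
  have h1 : ∑ s ∈ Finset.Icc 1 b, f s ≤ b * W := by
    have := Finset.sum_le_card_nsmul (Finset.Icc 1 b) f W fun s hs => by
      rw [Finset.mem_Icc] at hs
      exact hW s hs.1 hs.2
    simpa using this
  have h2 : ∑ s ∈ Finset.Icc (b + 1) a, (f s + f (a + b + 1 - s)) ≤ ((a : ℤ) - b) * C := by
    have := Finset.sum_le_card_nsmul (Finset.Icc (b + 1) a)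
      (fun s => f s + f (a + b + 1 - s)) C fun s hs => by
        rw [Finset.mem_Icc] at hs
        exact hC s (by omega) hs.2
    rw [nsmul_eq_mul, Nat.card_Icc] at this
    have e : ((a + 1 - (b + 1) : ℕ) : ℤ) = (a : ℤ) - b := by omega
    rwa [e] at this
  rw [Finset.sum_add_distrib, sum_Icc_reflect] at h2
  rw [hsplit]
  linarith

theorem not_middle_ineq {p h m lam N a d τ : ℕ} (hh : 5 ≤ h) (hm : 5 ≤ m)
    (hlam : lam + 3 ≤ h) (hcond : lam + 10 ≤ 2 * h) (hp : p = h * m + 2 + lam) (hpp : p.Prime)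
    (hN : 0 < N) (hd : 2 ≤ d) (hdh : d + 2 ≤ h) (hdτ : (d : ℤ) * a ≤ τ)
    (hpτ : (p : ℤ) * τ ≤ (p + h - 2) * N)
    (h2 : ((h : ℤ) - d) * (m * N) ≤ a * (p - 2 + (h - d))) : False := by
  have hhm : 5 * h ≤ h * m := by nlinarith
  have hpZ : (p : ℤ) = h * m + 2 + lam := by exact_mod_cast hp
  have hhZ : (5 : ℤ) ≤ h := by exact_mod_cast hh
  have hmZ : (5 : ℤ) ≤ m := by exact_mod_cast hm
  have hlZ : (lam : ℤ) + 3 ≤ h := by exact_mod_cast hlam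
  have hl0 : (0 : ℤ) ≤ lam := by positivity
  have hNZ : (1 : ℤ) ≤ N := by exact_mod_cast hN
  have hdZ : (2 : ℤ) ≤ d := by exact_mod_cast hd
  have hdhZ : (d : ℤ) + 2 ≤ h := by exact_mod_cast hdh
  set Q : ℤ := p - 2 + (h - d) with hQ
  have hpZ' : (0 : ℤ) < p := by exact_mod_cast hpp.pos
  have hQ0 : 0 ≤ Q := by linarith
  have h3 : (p * (d * ((h - d) * m)) : ℤ) * N ≤ ((p + h - 2) * Q) * N := by
    calc (p * (d * ((h - d) * m)) : ℤ) * N = (p * d) * ((h - d) * (m * N)) := by ring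
      _ ≤ (p * d) * (a * Q) := mul_le_mul_of_nonneg_left h2 (by positivity)
      _ = (p * Q) * (d * a) := by ring
      _ ≤ (p * Q) * τ := mul_le_mul_of_nonneg_left hdτ (by positivity)
      _ = (p * τ) * Q := by ring
      _ ≤ ((p + h - 2) * N) * Q := mul_le_mul_of_nonneg_right hpτ hQ0
      _ = ((p + h - 2) * Q) * N := by ring
  have h4 := le_of_mul_le_mul_right h3 (by linarith)
  have h5 : (p + h - 2) * Q ≤ ((p : ℤ) + h - 2) * (p + h - 4) :=
    mul_le_mul_of_nonneg_left (by linarith) (by linarith)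
  have h6 : (p : ℤ) * ((2 * (h - 2)) * m) ≤ p * (d * ((h - d) * m)) := by
    have : (2 * ((h : ℤ) - 2)) ≤ d * (h - d) := by
      have := mul_nonneg (sub_nonneg.2 hdZ) (sub_nonneg.2 hdhZ)
      linarith
    rw [← mul_assoc (d : ℤ)]
    exact mul_le_mul_of_nonneg_left (mul_le_mul_of_nonneg_right this (by linarith)) hpZ'.le
  have h7 : ((h : ℤ) - 4) * (5 * (h - 2)) < (h - 4) * p := by
    have : (5 : ℤ) * h ≤ h * m := by exact_mod_cast hhm
    exact mul_lt_mul_of_pos_left (by linarith) (by linarith)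
  have h8 : (p : ℤ) * (10 * ((h - 2) * m)) < p * (5 * p + 11 * h - 34) := by linarith
  have h9 := lt_of_mul_lt_mul_left h8 hpZ'.le
  have h10 : ((h : ℤ) - 4) * 5 ≤ (h - 4) * m :=
    mul_le_mul_of_nonneg_left hmZ (by linarith)
  have h11 : h ≤ 6 := by
    have : (h : ℤ) < 7 := by linarith
    omega
  interval_cases h
  · obtain rfl : lam = 0 := by omega
    have : m ≤ 6 := by push_cast at h9; omega
    interval_cases m <;> norm_num at hp <;> norm_num [hp] at hpp
  · have h12 : m = 5 ∧ lam = 2 := by push_cast at h9; omega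
    obtain ⟨rfl, rfl⟩ := h12
    norm_num at hp
    norm_num [hp] at hpp

theorem not_small_ineq {p h m lam N a b τ : ℕ} (hh : 5 ≤ h) (hm : 5 ≤ m)
    (hlam : lam + 3 ≤ h) (hp : p = h * m + 2 + lam) (ha : 1 ≤ a)
    (hbZ : (τ : ℤ) = (h - 1) * a + b) (hba : (b : ℤ) ≤ a)
    (hpτ : (p : ℤ) * τ ≤ (p + h - 2) * N)
    (h2 : (2 * m : ℤ) * N ≤ 2 * (b * (h * (m - 1))) + (a - b) * p) : False := by
  have hhm : 5 * h ≤ h * m := by nlinarith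
  have hpZ : (p : ℤ) = h * m + 2 + lam := by exact_mod_cast hp
  have hhZ : (5 : ℤ) ≤ h := by exact_mod_cast hh
  have hmZ : (5 : ℤ) ≤ m := by exact_mod_cast hm
  have hlZ : (lam : ℤ) + 3 ≤ h := by exact_mod_cast hlam
  have hl0 : (0 : ℤ) ≤ lam := by positivity
  have haZ : (1 : ℤ) ≤ a := by exact_mod_cast ha
  have hpZ' : (0 : ℤ) < p := by
    have : (5 : ℤ) * h ≤ h * m := by exact_mod_cast hhm
    linarith
  have hx : (0 : ℤ) ≤ a - b := by linarith
  have hb0 : (0 : ℤ) ≤ b := by positivity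
  have h3 : (2 * m : ℤ) * (p * τ) ≤ (2 * m) * ((p + h - 2) * N) :=
    mul_le_mul_of_nonneg_left hpτ (by positivity)
  have h4 : ((p : ℤ) + h - 2) * ((2 * m) * N) ≤
      (p + h - 2) * (2 * (b * (h * (m - 1))) + (a - b) * p) :=
    mul_le_mul_of_nonneg_left h2 (by linarith)
  have h5 : (p : ℤ) * (a - b) * (p + h - 2) ≤ p * (a - b) * (2 * m * (h - 1) - 1) := by
    have h6 : ((h : ℤ) - 2) * 5 ≤ (h - 2) * m :=
      mul_le_mul_of_nonneg_left hmZ (by linarith)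
    exact mul_le_mul_of_nonneg_left (by linarith) (mul_nonneg hpZ'.le hx)
  have h6 : (2 * h * b : ℤ) * ((p + h - 2) * (m - 1)) ≤ (2 * h * b) * (p * m - 1) :=
    mul_le_mul_of_nonneg_left (by linarith) (by positivity)
  have h7 : (p : ℤ) * (a - b) + 2 * h * b ≤ 0 := by
    rw [hbZ] at h3
    linarith
  have h8 : (0 : ℤ) ≤ p * (a - b) := mul_nonneg hpZ'.le hx
  have h9 : (0 : ℤ) ≤ 2 * h * b := by positivity
  have h10 : (p : ℤ) * (a - b) = 0 := by linarith
  have h11 : (2 * h * b : ℤ) = 0 := by linarith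
  rcases mul_eq_zero.1 h10 with h12 | h12
  · linarith
  · rcases mul_eq_zero.1 h11 with h13 | h13 <;> linarith

/-- The counting part of the weight dichotomy: `g s` is the number of layers of size at
least `s`, out of `p` layers in a space of size `N`, and `a` is the largest layer size. -/
theorem level_count_dichotomy {p h m lam N D a : ℕ} {g : ℕ → ℕ} (hh : 5 ≤ h) (hm : 5 ≤ m)
    (hlam : lam + 3 ≤ h) (hcond : lam + 10 ≤ 2 * h) (hp : p = h * m + 2 + lam) (hpp : p.Prime)
    (hN : 0 < N) (hD : p * D ≤ N) (ha : 1 ≤ a) (haN : a ≤ N)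
    (hanti : Antitone g) (hpos : 1 ≤ g a) (hsum : m * N ≤ ∑ s ∈ Finset.Icc 1 a, g s)
    (hmany : ∀ t : ℕ → ℕ, (∀ r < h, 1 ≤ t r ∧ t r ≤ a) →
      N + (h - 2) * D < ∑ r ∈ Finset.range h, t r →
      ∑ r ∈ Finset.range h, g (t r) ≤ p + (h - 2))
    (htwo : ∀ t : ℕ → ℕ, (∀ r < h, 1 ≤ t r ∧ t r ≤ a) →
      N < t 0 + t 1 → ∑ r ∈ Finset.range h, g (t r) ≤ p + (h - 2)) :
    g 1 ≤ m + 2 ∨ p - (h + lam + 2) < g 1 := by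
  by_contra! hcon
  obtain ⟨hw1, hw2⟩ := hcon
  set f : ℕ → ℤ := fun s => (g s : ℤ) - 1 with hf
  set W : ℤ := f 1 with hWdef
  have hfW : ∀ s, 1 ≤ s → f s ≤ W := fun s hs => by
    have := hanti hs
    simp only [hWdef, hf]
    omega
  have hf0 : ∀ s, s ≤ a → 0 ≤ f s := fun s hs => by
    have := hanti hs
    simp only [hf]
    omega
  have hW1 : (m : ℤ) + 2 ≤ W := by simp only [hWdef, hf]; omega
  have hpZ : (p : ℤ) = h * m + 2 + lam := by exact_mod_cast hp
  have hhm : 5 * h ≤ h * m := by nlinarith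
  have hW2 : W + 1 ≤ h * ((m : ℤ) - 1) := by
    have : g 1 + (h + lam + 2) ≤ p := by omega
    have : (g 1 : ℤ) + (h + lam + 2) ≤ p := by exact_mod_cast this
    simp only [hWdef, hf]
    linarith
  have hfsum : (m : ℤ) * N - a ≤ ∑ s ∈ Finset.Icc 1 a, f s := by
    have : (m : ℤ) * N ≤ ∑ s ∈ Finset.Icc 1 a, (g s : ℤ) := by exact_mod_cast hsum
    simp only [hf, Finset.sum_sub_distrib]
    simp
    linarith
  have hcastF : ∀ t : ℕ → ℕ, ∑ r ∈ Finset.range h, g (t r) ≤ p + (h - 2) →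
      ∑ r ∈ Finset.range h, f (t r) ≤ (p : ℤ) - 2 := fun t ht => by
    have : ∑ r ∈ Finset.range h, (g (t r) : ℤ) ≤ ((p + (h - 2) : ℕ) : ℤ) := by exact_mod_cast ht
    simp only [hf, Finset.sum_sub_distrib]
    simp
    omega
  have hmem : ∀ d s s', 1 ≤ s → s ≤ a → 1 ≤ s' → s' ≤ a → ∀ r < h,
      1 ≤ (if r = 0 then s else if r = 1 then s' else if r < d + 2 then a else 1) ∧
      (if r = 0 then s else if r = 1 then s' else if r < d + 2 then a else 1) ≤ a := by
    intro d s s' h1 h2 h3 h4 r _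
    split_ifs <;> omega
  have htwo' : ∀ s s', 1 ≤ s → s ≤ a → 1 ≤ s' → s' ≤ a → N < s + s' →
      f s + f s' + ((h : ℤ) - 2) * W ≤ (p : ℤ) - 2 := by
    intro s s' h1 h2 h3 h4 h5
    have := hcastF _ (htwo _ (hmem 0 s s' h1 h2 h3 h4) (by simpa using h5))
    rw [sum_range_levels f h 0 s s' a (by omega)] at this
    push_cast at this
    linarith
  set τ : ℕ := N + (h - 2) * D with hτ
  have hmany' : ∀ d s s', d + 2 ≤ h → 1 ≤ s → s ≤ a → 1 ≤ s' → s' ≤ a →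
      τ < s + s' + d * a →
      f s + f s' + ((h : ℤ) - d - 2) * W ≤ (p : ℤ) - 2 := by
    intro d s s' hd h1 h2 h3 h4 h5
    have := hcastF _ (hmany _ (hmem d s s' h1 h2 h3 h4) (by
      have e := sum_range_levels (fun x => (x : ℤ)) h d s s' a hd
      rw [← Nat.cast_lt (α := ℤ), Nat.cast_sum, e]
      have h6 : ((N + (h - 2) * D : ℕ) : ℤ) < s + s' + d * a := by exact_mod_cast h5
      have : (0 : ℤ) ≤ ((h : ℤ) - d - 2) := by omega
      rw [Nat.cast_one]
      linarith))
    rw [sum_range_levels f h d s s' a hd] at this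
    have h6 : 0 ≤ (d : ℤ) * f a := mul_nonneg (by positivity) (hf0 a le_rfl)
    linarith
  have hhZ : (5 : ℤ) ≤ h := by exact_mod_cast hh
  have hmZ : (5 : ℤ) ≤ m := by exact_mod_cast hm
  have hlZ : (lam : ℤ) + 3 ≤ h := by exact_mod_cast hlam
  have hcZ : (lam : ℤ) + 10 ≤ 2 * h := by exact_mod_cast hcond
  have hl0 : (0 : ℤ) ≤ lam := by positivity
  have haZ : (1 : ℤ) ≤ a := by exact_mod_cast ha
  have hpτ : (p : ℤ) * τ ≤ (p + h - 2) * N := by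
    have h1 : (p : ℤ) * D ≤ N := by exact_mod_cast hD
    have h2 : ((h - 2 : ℕ) : ℤ) = h - 2 := by omega
    rw [hτ]
    push_cast [h2]
    nlinarith
  rcases lt_or_ge N (2 * a) with hbig | hsmall
  · -- a pair of layers already fills the space
    have h1 := two_mul_sum_Icc_le (f := f) (a := a) (b := N - a) (W := W)
      (C := (p : ℤ) - 2 - (h - 2) * W) (by omega) (fun s hs _ => hfW s hs)
      (fun s hs hsa => by
        have := htwo' s (a + (N - a) + 1 - s) (by omega) hsa (by omega) (by omega) (by omega)
        linarith)
    have h2 : ((N - a : ℕ) : ℤ) = (N : ℤ) - a := by omega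
    rw [h2] at h1
    have h3 := htwo' a a ha le_rfl ha le_rfl (by omega)
    have h4 := hf0 a le_rfl
    have hx : (0 : ℤ) < 2 * a - N := by omega
    have hy : (0 : ℤ) ≤ (N : ℤ) - a := by omega
    have hWlt : W < 2 * m - 1 := by
      by_contra! hc
      have h5 : ((h : ℤ) - 2) * (2 * m - 1) ≤ (h - 2) * W :=
        mul_le_mul_of_nonneg_left hc (by linarith)
      have h6 : ((h : ℤ) - 4) * 5 ≤ (h - 4) * m :=
        mul_le_mul_of_nonneg_left hmZ (by linarith)
      linarith
    have h5 : (p : ℤ) - 2 - (h - 2) * W < 2 * m - 2 := by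
      have h6 : ((h : ℤ) - 2) * (m + 2) ≤ (h - 2) * W :=
        mul_le_mul_of_nonneg_left hW1 (by linarith)
      linarith
    have h7 := mul_pos hx (sub_pos.2 h5)
    have h8 := mul_nonneg hy (sub_pos.2 hWlt).le
    linarith
  · set d := τ / a with hd
    have hd1 : d * a ≤ τ := Nat.div_mul_le_self _ _
    have hd2 : τ < (d + 1) * a := by
      rw [mul_comm]
      exact Nat.lt_mul_div_succ _ ha
    have hd3 : 2 ≤ d := (Nat.le_div_iff_mul_le ha).2 (by omega)
    clear_value d τ
    rcases le_or_gt (d + 2) h with hdh | hdh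
    · have h1 := two_mul_sum_Icc_le (f := f) (a := a) (b := 0) (W := W)
        (C := (p : ℤ) - 2 - (h - d - 2) * W) (by omega) (fun s _ hs => hfW s (by omega))
        (fun s hs hsa => by
          have := hmany' d s (a + 0 + 1 - s) hdh (by omega) hsa (by omega) (by omega) (by
            have : s + (a + 0 + 1 - s) = a + 1 := by omega
            rw [this]
            linarith)
          linarith)
      have haW : ∑ s ∈ Finset.Icc 1 a, f s ≤ a * W := by
        have := Finset.sum_le_card_nsmul (Finset.Icc 1 a) f W fun s hs =>
          hfW s (Finset.mem_Icc.1 hs).1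
        simpa using this
      have hdZ : (2 : ℤ) ≤ d := by exact_mod_cast hd3
      have hdhZ : (d : ℤ) + 2 ≤ h := by exact_mod_cast hdh
      have hdτ : (d : ℤ) * a ≤ τ := by exact_mod_cast hd1
      have h2 : ((h : ℤ) - d) * (m * N) ≤ a * (p - 2 + (h - d)) := by
        have h3 : ((h : ℤ) - d - 2) * (m * N - a) ≤ (h - d - 2) * (a * W) :=
          mul_le_mul_of_nonneg_left (hfsum.trans haW) (by linarith)
        simp only [Nat.cast_zero, zero_mul, mul_zero, zero_add, sub_zero] at h1
        linarith
      exact not_middle_ineq hh hm hlam hcond hp hpp hN hd3 hdh hdτ hpτ h2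
    · have hτa : (h - 1) * a ≤ τ := le_trans (Nat.mul_le_mul_right _ (by omega)) hd1
      have haW : ∑ s ∈ Finset.Icc 1 a, f s ≤ a * W := by
        have := Finset.sum_le_card_nsmul (Finset.Icc 1 a) f W fun s hs =>
          hfW s (Finset.mem_Icc.1 hs).1
        simpa using this
      have hpZ' : (0 : ℤ) < p := by exact_mod_cast hpp.pos
      have hph : ((m : ℤ) - 1) * (h - 2) < p := by linarith
      have hτh : (τ : ℤ) ≤ h * a := by
        by_contra! hc
        have h1 : (m : ℤ) * N ≤ a * (h * (m - 1)) := by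
          have := mul_le_mul_of_nonneg_left hW2 (by linarith : (0 : ℤ) ≤ a)
          linarith
        have h2 : ((p : ℤ) * m) * (h * a) < (p * m) * τ :=
          mul_lt_mul_of_pos_left hc (by positivity)
        have h3 : (m : ℤ) * (p * τ) ≤ m * ((p + h - 2) * N) :=
          mul_le_mul_of_nonneg_left hpτ (by positivity)
        have h4 : ((p : ℤ) + h - 2) * (m * N) ≤ (p + h - 2) * (a * (h * (m - 1))) :=
          mul_le_mul_of_nonneg_left h1 (by linarith)
        have h5 : (h * a : ℤ) * (p * m) < (h * a) * ((p + h - 2) * (m - 1)) := by linarith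
        have h6 := lt_of_mul_lt_mul_left h5 (by positivity)
        linarith
      obtain ⟨b, hb⟩ := Nat.exists_eq_add_of_le hτa
      have hh1 : ((h - 1 : ℕ) : ℤ) = h - 1 := by omega
      have hh2 : ((h - 2 : ℕ) : ℤ) = h - 2 := by omega
      have hbZ : (τ : ℤ) = (h - 1) * a + b := by rw [hb]; push_cast [hh1]; ring
      have hba : (b : ℤ) ≤ a := by linarith
      have h1 := two_mul_sum_Icc_le (f := f) (a := a) (b := b) (W := W)
        (C := (p : ℤ) - 2) (by exact_mod_cast hba) (fun s hs _ => hfW s hs)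
        (fun s hs hsa => by
          have := hmany' (h - 2) s (a + b + 1 - s) (by omega) (by omega) hsa (by omega)
            (by omega) (by
              have h3 : s + (a + b + 1 - s) = a + b + 1 := by omega
              rw [h3]
              zify
              rw [hbZ, hh2]
              linarith)
          rw [hh2] at this
          linarith)
      have h2 : (2 * m : ℤ) * N ≤ 2 * (b * (h * (m - 1))) + (a - b) * p := by
        have := mul_le_mul_of_nonneg_left hW2 (by positivity : (0 : ℤ) ≤ b)
        linarith
      exact not_small_ineq hh hm hlam hp ha hbZ hba hpτ h2

theorem card_addSubgroup_mul_le {G : Type*} [AddCommGroup G] [Finite G] {p d : ℕ}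
    (hp : p.Prime) (hG : Nat.card G = p ^ d) {H : AddSubgroup G} (hH : H ≠ ⊤) :
    Nat.card H * p ≤ Nat.card G := by
  have h1 : H.index ∣ p ^ d := hG ▸ H.index_dvd_card
  have h2 : H.index ≠ 1 := fun h => hH (AddSubgroup.index_eq_one.1 h)
  obtain ⟨e, -, he⟩ := (Nat.dvd_prime_pow hp).1 h1
  rw [← H.card_mul_index]
  refine Nat.mul_le_mul_left _ ?_
  rw [he] at h2 ⊢
  exact Nat.le_self_pow (fun h => h2 (by simp [h])) p

theorem sum_card_superlevel {ι : Type*} [Fintype ι] (c : ι → ℕ) (a : ℕ) (hc : ∀ i, c i ≤ a) :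
    ∑ s ∈ Finset.Icc 1 a, (Finset.univ.filter fun i => s ≤ c i).card = ∑ i, c i := by
  simp only [Finset.card_filter]
  rw [Finset.sum_comm]
  refine Finset.sum_congr rfl fun i _ => ?_
  rw [← Finset.card_filter]
  have : (Finset.Icc 1 a).filter (fun s => s ≤ c i) = Finset.Icc 1 (c i) := by
    ext s
    have := hc i
    simp only [Finset.mem_filter, Finset.mem_Icc]
    omega
  rw [this, Nat.card_Icc, Nat.add_sub_cancel]

/-- The dichotomy for an abstract family `L` of subsets of a group of order `p ^ d`, indexed
by `ZMod p`, such that no `k`-fold sum meets an `l`-fold sum at equal indices. -/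
theorem family_dichotomy {G : Type*} [AddCommGroup G] [Fintype G] [DecidableEq G]
    {k l d m lam p : ℕ} [Fact p.Prime] (hlk : l < k) (hl : 1 ≤ l) (hm : 5 ≤ m)
    (hlam : lam ≤ k + l - 3) (hcond : (lam : ℤ) ≤ 2 * ((k : ℤ) + l - 5))
    (hp : p = (k + l) * m + 2 + lam) (hG : Fintype.card G = p ^ d)
    (L : ZMod p → Finset G) (hcard : m * p ^ d ≤ ∑ i, (L i).card)
    (hfree : ∀ (i : ℕ → ZMod p) (z : ℕ → G), (∀ r < k + l, z r ∈ L (i r)) →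
      ∑ r ∈ Finset.range k, i r = ∑ r ∈ Finset.range l, i (k + r) →
      ∑ r ∈ Finset.range k, z r ≠ ∑ r ∈ Finset.range l, z (k + r)) :
    (Finset.univ.filter fun i => 1 ≤ (L i).card).card ≤ m + 2 ∨
      p - (k + l + lam + 2) < (Finset.univ.filter fun i => 1 ≤ (L i).card).card := by
  have hpp : p.Prime := Fact.out
  have hGD : ∀ H : AddSubgroup G, H ≠ ⊤ → Nat.card H ≤ p ^ d / p := fun H hH => by
    have hN : Nat.card G = p ^ d := by rw [Nat.card_eq_fintype_card, hG]
    rw [Nat.le_div_iff_mul_le hpp.pos, ← hN]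
    exact card_addSubgroup_mul_le hpp hN hH
  have hZD : ∀ H : AddSubgroup (ZMod p), H ≠ ⊤ → Nat.card H ≤ 1 := fun H hH => by
    have hN : Nat.card (ZMod p) = p ^ 1 := by simp
    have := card_addSubgroup_mul_le hpp hN hH
    rw [hN, pow_one] at this
    exact Nat.le_of_mul_le_mul_right (by simpa using this) hpp.pos
  have hNpos : 0 < p ^ d := pow_pos hpp.pos d
  obtain ⟨i₀, -, hi₀⟩ := Finset.exists_max_image (Finset.univ : Finset (ZMod p))
    (fun i => (L i).card) ⟨0, Finset.mem_univ _⟩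
  have hmax : ∀ i, (L i).card ≤ (L i₀).card := fun i => hi₀ i (Finset.mem_univ _)
  have ha : 1 ≤ (L i₀).card := by
    by_contra hc
    have : ∑ i, (L i).card = 0 := Finset.sum_eq_zero fun i _ => by
      have := hmax i
      omega
    rw [this] at hcard
    have : 0 < m * p ^ d := Nat.mul_pos (by omega) hNpos
    omega
  have key : ∀ t : ℕ → ℕ, (∀ r < k + l, 1 ≤ t r ∧ t r ≤ (L i₀).card) →
      (∀ i : ℕ → ZMod p, (∀ r < k + l, t r ≤ (L (i r)).card) →
        ¬ (∑ r ∈ Finset.range (k + l), (L (i r)).card ≤ p ^ d + (k + l - 2) * (p ^ d / p) ∧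
          (L (i 0)).card + (L (i 1)).card ≤ p ^ d)) →
      ∑ r ∈ Finset.range (k + l), (Finset.univ.filter fun i => t r ≤ (L i).card).card ≤
        p + (k + l - 2) := by
    intro t ht hbig
    have := (card_le_of_forall_sum_ne hZD k l (by omega)
      (fun r => Finset.univ.filter fun i => t r ≤ (L i).card)
      (fun r hr => ⟨i₀, by simpa using (ht r hr).2⟩) (fun i hi heq => by
        have hi' : ∀ r < k + l, t r ≤ (L (i r)).card := fun r hr => by simpa using hi r hr
        refine hbig i hi' ?_
        rw [← hG]
        rw [← hG] at hGD
        exact card_le_of_forall_sum_ne hGD k l (by omega) (fun r => L (i r))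
          (fun r hr => Finset.card_pos.1 ((ht r hr).1.trans (hi' r hr)))
          fun z hz => hfree i z hz heq)).1
    simpa using this
  refine level_count_dichotomy (p := p) (h := k + l) (N := p ^ d) (D := p ^ d / p)
    (a := (L i₀).card) (g := fun s => (Finset.univ.filter fun i => s ≤ (L i).card).card)
    (by omega) hm (by omega) (by omega) hp hpp hNpos (Nat.mul_div_le _ _) ha
    (hG ▸ Finset.card_le_univ _) ?_ ?_ ?_ ?_ ?_
  · intro s s' hs
    exact Finset.card_le_card (Finset.monotone_filter_right _ fun i _ hi => hs.trans hi)
  · exact Finset.card_pos.2 ⟨i₀, by simp⟩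
  · rw [sum_card_superlevel _ _ hmax]
    exact hcard
  · intro t ht hlt
    refine key t ht fun i hi hc => ?_
    have := Finset.sum_le_sum fun r hr => hi r (Finset.mem_range.1 hr)
    omega
  · intro t ht hlt
    refine key t ht fun i hi hc => ?_
    have h0 := hi 0 (by omega)
    have h1 := hi 1 (by omega)
    omega

theorem bijective_add_smul {p n : ℕ} [Fact p.Prime] (hn : 1 ≤ n) {v : Fin n → ZMod p}
    {K : Submodule (ZMod p) (Fin n → ZMod p)}
    (hK : Module.finrank (ZMod p) K = n - 1) (hv : v ∉ K) :
    Function.Bijective fun x : ZMod p × K => (x.2 : Fin n → ZMod p) + x.1 • v := by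
  have hinj : Function.Injective fun x : ZMod p × K => (x.2 : Fin n → ZMod p) + x.1 • v := by
    rintro ⟨i, x⟩ ⟨j, y⟩ h
    have h' : (x : Fin n → ZMod p) + i • v = y + j • v := h
    have hij : i = j := by
      by_contra hne
      have h1 : (i - j) • v = (y : Fin n → ZMod p) - x := by
        rw [sub_smul, sub_eq_sub_iff_add_eq_add, add_comm, h']
      exact hv ((K.smul_mem_iff (sub_ne_zero.2 hne)).1 (h1 ▸ K.sub_mem y.2 x.2))
    subst hij
    rw [add_left_inj] at h'
    rw [Subtype.ext h']
  refine hinj.bijective_of_nat_card_le ?_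
  rw [Nat.card_prod, Module.natCard_eq_pow_finrank (K := ZMod p) (V := K), hK]
  simp only [Nat.card_zmod, Nat.card_pi, Finset.prod_const, Finset.card_univ, Fintype.card_fin]
  rw [← pow_succ', Nat.sub_add_cancel hn]

/-- (Weight dichotomy.) If `2(k+ℓ-5) ≥ λ` and `m ≥ 5`, then for every
decomposition, either `ω(A) ≤ m+2` or `ω(A) > p - θ` with `θ = k+ℓ+λ+2`. -/
theorem stmt14 (k l n m lam p : ℕ) (hlk : l < k) (hl : 1 ≤ l) (hn : 1 ≤ n) (hm : 5 ≤ m)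
    (hlam : lam ≤ k + l - 3) (hcond : (lam : ℤ) ≤ 2 * ((k : ℤ) + l - 5))
    (hp : p = (k + l) * m + 2 + lam) (hpp : p.Prime)
    (A : Set (Fin n → ZMod p)) (hA : A.Nonempty) (hfree : KLFree k l A)
    (hcard : m * p ^ (n - 1) ≤ A.ncard)
    (v : Fin n → ZMod p) (K : Submodule (ZMod p) (Fin n → ZMod p))
    (hK : Module.finrank (ZMod p) K = n - 1) (hv : v ∉ K) :
    weight v K A ≤ m + 2 ∨ p - (k + l + lam + 2) < weight v K A := by
  classical
  have : Fact p.Prime := ⟨hpp⟩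
  have hbij := bijective_add_smul hn hK hv
  let L : ZMod p → Finset K := fun i =>
    Finset.univ.filter fun x => (x : Fin n → ZMod p) + i • v ∈ A
  have hG : Fintype.card K = p ^ (n - 1) := by
    rw [← Nat.card_eq_fintype_card, Module.natCard_eq_pow_finrank (K := ZMod p) (V := K), hK,
      Nat.card_zmod]
  have hsum : ∑ i, (L i).card = A.ncard := by
    rw [← Finset.card_sigma, ← Nat.card_eq_finsetCard, ← Nat.card_coe_set_eq]
    refine Nat.card_congr (Equiv.ofBijective
      (fun x => ⟨(x.1.2 : Fin n → ZMod p) + x.1.1 • v,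
        (Finset.mem_filter.1 (Finset.mem_sigma.1 x.2).2).2⟩) ⟨?_, ?_⟩)
    · rintro ⟨⟨i, x⟩, hx⟩ ⟨⟨j, y⟩, hy⟩ h
      have := hbij.1 (a₁ := (i, x)) (a₂ := (j, y)) (congrArg Subtype.val h)
      simp only [Prod.mk.injEq] at this
      obtain ⟨rfl, rfl⟩ := this
      rfl
    · rintro ⟨u, hu⟩
      obtain ⟨⟨i, x⟩, rfl⟩ := hbij.2 u
      exact ⟨⟨⟨i, x⟩, by simpa [L] using hu⟩, rfl⟩
  have hweight : weight v K A = (Finset.univ.filter fun i => 1 ≤ (L i).card).card := by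
    rw [weight, ← Set.ncard_coe_finset]
    congr 1
    ext i
    simp only [supp, layerKL, Set.mem_ofPred_eq, Finset.coe_filter, Finset.mem_univ, true_and,
      Finset.one_le_card]
    constructor
    · rintro ⟨x, hxK, hxA⟩
      exact ⟨⟨x, hxK⟩, by simpa [L] using hxA⟩
    · rintro ⟨x, hx⟩
      exact ⟨x, x.2, by simpa [L] using hx⟩
  rw [hweight]
  refine family_dichotomy hlk hl hm hlam hcond hp hG L (hsum ▸ hcard) fun i z hz hi heq => ?_
  have hmem : ∀ r < k + l, (z r : Fin n → ZMod p) + i r • v ∈ A := fun r hr => by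
    simpa [L] using hz r hr
  have h1 := sum_range_mem_itSum (A := A) (fun r => (z r : Fin n → ZMod p) + i r • v) k
    fun r hr => hmem r (by omega)
  have h2 := sum_range_mem_itSum (A := A)
    (fun r => (z (k + r) : Fin n → ZMod p) + i (k + r) • v) l fun r hr => hmem _ (by omega)
  have heq' := congrArg (Subtype.val : K → Fin n → ZMod p) heq
  push_cast at heq'
  rw [Finset.sum_add_distrib, ← Finset.sum_smul] at h1 h2
  rw [← hi, ← heq'] at h2
  exact (Set.eq_empty_iff_forall_notMem.1 hfree _) ⟨h1, h2⟩
end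

section
/- Let k > ℓ ≥ 1 with k+ℓ ≥ 4 and 0 ≤ λ ≤ k+ℓ−3, let p = (k+ℓ)m+2+λ be prime with m ≥ 9+λ, and let n ≥ 1. Suppose A ⊆ F_p^n is a (k,ℓ)-sum-free set with |A| ≥ m·p^{n−1}, and suppose that under some decomposition (v,K) of F_p^n one has ω(A) > p − θ, where θ = k+ℓ+λ+2. Then there exists a nonnegative integer u such that Σ_{i ∈ F_p} | |A_i| − u | ≤ (2+θ)·p^{n−1} (the sum of absolute differences taken in the integers). -/
open Pointwise

/-- Weak form of Kneser's theorem: `q` is a lower bound for the index of proper subgroups. -/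
lemma add_eq_univ_or_card_add_card_le {G : Type*} [AddCommGroup G] [Fintype G] [DecidableEq G]
    (q : ℕ) (hq : ∀ H : AddSubgroup G, H ≠ ⊤ → q * Nat.card H ≤ Fintype.card G)
    (A B : Finset G) (hA : A.Nonempty) (hB : B.Nonempty) :
    A + B = Finset.univ ∨ q * (A.card + B.card) ≤ q * (A + B).card + Fintype.card G := by
  induction hc : B.card using Nat.strong_induction_on generalizing A B with
  | _ c ih =>
  subst hc
  by_cases hstab : ∃ e ∈ A, ∃ b₀ ∈ B, ∃ b ∈ B, e - b₀ + b ∉ A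
  · obtain ⟨e, he, b₀, hb₀, b, hb, hnot⟩ := hstab
    set t := e - b₀
    set A' := A ∪ B.image (fun x => t + x)
    set B' := B.filter (fun x => t + x ∈ A)
    have hlt : B'.card < B.card :=
      Finset.card_lt_card (Finset.filter_ssubset.2 ⟨b, hb, hnot⟩)
    have hA' : A'.Nonempty := hA.mono Finset.subset_union_left
    have hB' : B'.Nonempty := ⟨b₀, by simp [B', t, hb₀, he]⟩
    have hsum : A'.card + B'.card = A.card + B.card := by
      have h1 := Finset.card_union_add_card_inter A (B.image (fun x => t + x))
      have h2 : (A ∩ B.image (fun x => t + x)) = B'.image (fun x => t + x) := by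
        ext y
        simp only [Finset.mem_inter, Finset.mem_image, B', Finset.mem_filter]
        constructor
        · rintro ⟨h, x, hx, rfl⟩
          exact ⟨x, ⟨hx, h⟩, rfl⟩
        · rintro ⟨x, ⟨hx, h⟩, rfl⟩
          exact ⟨h, x, hx, rfl⟩
      rw [h2, Finset.card_image_of_injective _ (add_right_injective t),
        Finset.card_image_of_injective _ (add_right_injective t)] at h1
      exact h1
    have hsub : A' + B' ⊆ A + B := by
      intro y hy
      obtain ⟨a, ha, x, hx, rfl⟩ := Finset.mem_add.1 hy
      obtain ⟨hxB, hxA⟩ := Finset.mem_filter.1 hx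
      rcases Finset.mem_union.1 ha with ha | ha
      · exact Finset.add_mem_add ha hxB
      · obtain ⟨z, hz, rfl⟩ := Finset.mem_image.1 ha
        have : t + z + x = (t + x) + z := by abel
        rw [this]
        exact Finset.add_mem_add hxA hz
    rcases ih _ hlt A' B' hA' hB' rfl with h | h
    · left
      exact Finset.univ_subset_iff.1 (h ▸ hsub)
    · right
      rw [← hsum]
      have := Nat.mul_le_mul_left q (Finset.card_le_card hsub)
      omega
  · push Not at hstab
    obtain ⟨b₀, hb₀⟩ := hB
    let H : AddSubgroup G := AddSubgroup.closure ((fun x => x - b₀) '' (B : Set G))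
    have hHA : ∀ g ∈ H, ∀ a ∈ A, a + g ∈ A := by
      intro g hg
      induction hg using AddSubgroup.closure_induction with
      | mem x hx =>
        obtain ⟨b, hb, rfl⟩ := hx
        intro a ha
        have := hstab a ha b₀ hb₀ b hb
        rwa [show a - b₀ + b = a + (b - b₀) by abel] at this
      | zero => intro a ha; simpa using ha
      | add x y _ _ hx hy =>
        intro a ha
        rw [← add_assoc]
        exact hy _ (hx _ ha)
      | neg x _ hx =>
        intro a ha
        have himg : A.image (fun a => a + x) = A := by
          apply Finset.eq_of_subset_of_card_le
          · intro y hy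
            obtain ⟨a, ha, rfl⟩ := Finset.mem_image.1 hy
            exact hx a ha
          · rw [Finset.card_image_of_injective _ (add_left_injective x)]
        rw [← himg] at ha
        obtain ⟨a', ha', rfl⟩ := Finset.mem_image.1 ha
        simpa using ha'
    have hAle : A.card ≤ (A + B).card :=
      Finset.card_le_card_add_right ⟨b₀, hb₀⟩
    by_cases htop : H = ⊤
    · left
      obtain ⟨a, ha⟩ := hA
      have hAuniv : A = Finset.univ := by
        ext y
        simp only [Finset.mem_univ, iff_true]
        have := hHA (y - a) (htop ▸ AddSubgroup.mem_top _) a ha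
        simpa using this
      rw [hAuniv] at hAle
      exact Finset.eq_univ_of_card _ (le_antisymm (Finset.card_le_univ _)
        (by simpa [hAuniv] using hAle))
    · right
      have hBH : B.card ≤ Nat.card H := by
        rw [← Finset.card_image_of_injective B (sub_left_injective (b := b₀))]
        rw [← Set.ncard_coe_finset, ← SetLike.coe_sort_coe, Nat.card_coe_set_eq]
        refine Set.ncard_le_ncard ?_ (Set.toFinite _)
        rw [Finset.coe_image]
        exact AddSubgroup.subset_closure
      have h1 := hq H htop
      have h2 := Nat.mul_le_mul_left q hBH
      have h3 := Nat.mul_le_mul_left q hAle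
      rw [mul_add]
      omega

lemma univ_add_eq_univ_of_nonempty {G : Type*} [AddCommGroup G] [Fintype G] [DecidableEq G]
    {X : Finset G} (hX : X.Nonempty) : (Finset.univ : Finset G) + X = Finset.univ := by
  obtain ⟨x, hx⟩ := hX
  refine Finset.eq_univ_of_forall fun y => Finset.mem_add.2 ⟨y - x, Finset.mem_univ _, x, hx, ?_⟩
  abel

lemma add_nsmul_eq_univ_or_card_le {G : Type*} [AddCommGroup G] [Fintype G] [DecidableEq G]
    (q : ℕ) (hq : ∀ H : AddSubgroup G, H ≠ ⊤ → q * Nat.card H ≤ Fintype.card G)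
    (X Y : Finset G) (hX : X.Nonempty) (hY : Y.Nonempty) (r : ℕ) :
    Y + r • X = Finset.univ ∨
      q * (Y.card + r * X.card) ≤ q * (Y + r • X).card + r * Fintype.card G := by
  induction r with
  | zero => right; simp
  | succ r ih =>
    rw [succ_nsmul, ← add_assoc]
    have hne : (Y + r • X).Nonempty := hY.add hX.nsmul
    rcases ih with h | h
    · left
      rw [h]
      exact univ_add_eq_univ_of_nonempty hX
    · rcases add_eq_univ_or_card_add_card_le q hq (Y + r • X) X hne hX with h' | h'
      · exact Or.inl h'
      · right
        nlinarith

lemma add_nsmul_mem_itSum {V ι : Type*} [AddCommGroup V] [AddCommGroup ι] [DecidableEq ι]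
    (f : ι →+ V) (w : V) (A : Set V) (X : Finset ι) (hX : ∀ x ∈ X, f x + w ∈ A) (r : ℕ)
    (x : ι) (hx : x ∈ r • X) : f x + r • w ∈ itSum r A := by
  induction r generalizing x with
  | zero =>
    obtain rfl : x = 0 := by simpa using hx
    simp [itSum]
  | succ r ih =>
    rw [succ_nsmul] at hx
    obtain ⟨y, hy, z, hz, rfl⟩ := Finset.mem_add.1 hx
    refine ⟨f y + r • w, ih y hy, f z + w, hX z hz, ?_⟩
    simp only [map_add, succ_nsmul]
    abel

lemma card_layers_le_of_disjoint {G : Type*} [AddCommGroup G] [Fintype G] [DecidableEq G]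
    (q : ℕ) (hq : ∀ H : AddSubgroup G, H ≠ ⊤ → q * Nat.card H ≤ Fintype.card G)
    (X Y Z : Finset G) (hX : X.Nonempty) (hY : Y.Nonempty) (hZ : Z.Nonempty) (r s : ℕ)
    (hdisj : Disjoint (Y + Z + r • X) (X + s • X)) :
    q * (Y.card + Z.card + (r + 1 + s) * X.card) ≤
      q * Fintype.card G + (r + 1 + s) * Fintype.card G := by
  have hYZ : (Y + Z).Nonempty := hY.add hZ
  have hP : (Y + Z + r • X).Nonempty := hYZ.add hX.nsmul
  have hQ : (X + s • X).Nonempty := hX.add hX.nsmul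
  have hPu : Y + Z + r • X ≠ Finset.univ := by
    intro h
    rw [h] at hdisj
    obtain ⟨y, hy⟩ := hQ
    exact Finset.disjoint_left.1 hdisj (Finset.mem_univ y) hy
  have hQu : X + s • X ≠ Finset.univ := by
    intro h
    rw [h] at hdisj
    obtain ⟨y, hy⟩ := hP
    exact Finset.disjoint_left.1 hdisj hy (Finset.mem_univ y)
  have hYZu : Y + Z ≠ Finset.univ := by
    intro h
    rw [h, univ_add_eq_univ_of_nonempty hX.nsmul] at hPu
    exact hPu rfl
  have h1 := (add_eq_univ_or_card_add_card_le q hq Y Z hY hZ).resolve_left hYZu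
  have h2 := (add_nsmul_eq_univ_or_card_le q hq X (Y + Z) hX hYZ r).resolve_left hPu
  have h3 := (add_nsmul_eq_univ_or_card_le q hq X X hX hX s).resolve_left hQu
  have h4 : (Y + Z + r • X).card + (X + s • X).card ≤ Fintype.card G := by
    rw [← Finset.card_union_of_disjoint hdisj]
    exact Finset.card_le_univ _
  have h5 := Nat.mul_le_mul_left q h4
  nlinarith

lemma balance_polynomial_pos (h m lam r : ℤ) (hh : 4 ≤ h) (hl0 : 0 ≤ lam) (hlam : lam ≤ h - 3)
    (hm : 9 + lam ≤ m) (hr0 : 0 ≤ r) (hr : r ≤ 2 * (h + lam + 1)) :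
    0 < (h * m + 2 + lam) * ((h - 2) * (h + 1) + (h - 3) * (lam + 2)) +
      r * (m + lam + h - (h - 1) * (h + lam + 4)) := by
  have key : 2 * (h + lam + 1) * ((h - 1) * (h + lam + 4)) <
      h * (9 + lam) * ((h - 2) * (h + 1) + (h - 3) * (lam + 2)) := by
    rcases hl0.eq_or_lt with h0 | h0
    · subst h0
      obtain ⟨a, rfl⟩ : ∃ a, h = 4 + a := ⟨h - 4, by ring⟩
      have ha : 0 ≤ a := by linarith
      rw [← sub_pos]
      ring_nf
      positivity
    · obtain ⟨b, rfl⟩ : ∃ b, lam = 1 + b := ⟨lam - 1, by ring⟩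
      obtain ⟨a, rfl⟩ : ∃ a, h = 4 + b + a := ⟨h - 4 - b, by ring⟩
      have ha : 0 ≤ a := by linarith
      have hb : 0 ≤ b := by linarith
      rw [← sub_pos]
      ring_nf
      positivity
  have hC : 0 ≤ (h - 2) * (h + 1) + (h - 3) * (lam + 2) := by nlinarith
  have hD : 0 ≤ (h - 1) * (h + lam + 4) := by nlinarith
  have h1 : h * (9 + lam) ≤ h * m + 2 + lam := by nlinarith
  have h2 := mul_le_mul_of_nonneg_right h1 hC
  have h3 := mul_le_mul_of_nonneg_right hr hD
  have h4 : 0 ≤ r * (m + lam + h) := mul_nonneg hr0 (by linarith)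
  nlinarith

lemma max_layer_bound (h m lam r p N M : ℤ) (hh : 4 ≤ h) (hl0 : 0 ≤ lam) (hlam : lam ≤ h - 3)
    (hm : 9 + lam ≤ m) (hr0 : 0 ≤ r) (hr : r ≤ 2 * (h + lam + 1)) (hp : p = h * m + 2 + lam)
    (hN : 0 < N)
    (hsum : 2 * p * (m * N) ≤ (p - r) * ((p + h - 2) * N - (h - 2) * (p * M)) + r * (p * M)) :
    p * M - m * N ≤ (h + lam + 4) * N := by
  by_contra! hcon
  have hQ := balance_polynomial_pos h m lam r hh hl0 hlam hm hr0 hr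
  have hc : 0 ≤ p * (h - 2) - r * (h - 1) := by
    have h1 : r * (h - 1) ≤ 2 * (h + lam + 1) * (h - 1) :=
      mul_le_mul_of_nonneg_right hr (by linarith)
    have h2 : 3 * (h + lam + 1) ≤ p := by rw [hp]; nlinarith
    have h3 := mul_le_mul_of_nonneg_right h2 (show 0 ≤ h - 2 by linarith)
    nlinarith
  have hW : 0 ≤ p * M - (m + h + lam + 4) * N := by linarith
  have h1 := mul_nonneg hW hc
  have h2 := mul_pos hN hQ
  subst hp
  nlinarith

/-- Sum bound for a function on a finite group whose zero set is small and whose values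
at `x` and `c - x` have sum at most `B` whenever both are non-zero. -/
lemma two_mul_sum_le_of_reflection {ι : Type*} [AddCommGroup ι] [Fintype ι]
    (a : ι → ℤ) (c : ι) (M B : ℤ) (t : ℕ)
    (ha : ∀ x, a x ≤ M) (ht : (Finset.univ.filter fun x => a x = 0).card ≤ t)
    (hB : ∀ x, a x ≠ 0 → a (c - x) ≠ 0 → a x + a (c - x) ≤ B) :
    ∃ r : ℕ, r ≤ 2 * t ∧ 2 * ∑ x, a x ≤ ((Fintype.card ι : ℤ) - r) * B + r * M := by
  classical
  set R := Finset.univ.filter fun x => a x = 0 ∨ a (c - x) = 0 with hR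
  have hinv : ∑ x, a (c - x) = ∑ x, a x := Equiv.sum_comp (Equiv.subLeft c) a
  refine ⟨R.card, ?_, ?_⟩
  · rw [hR, Finset.filter_or]
    refine (Finset.card_union_le _ _).trans ?_
    have : (Finset.univ.filter fun x => a (c - x) = 0).card =
        (Finset.univ.filter fun x => a x = 0).card := by
      refine Finset.card_bij (fun x _ => c - x) ?_ ?_ ?_
      · intro x hx; simpa using hx
      · intro x _ y _ hxy; simpa using hxy
      · intro y hy; exact ⟨c - y, by simpa using hy, by simp⟩
    omega
  · have hle : ∑ x, (a x + a (c - x)) ≤ ∑ x, (if x ∈ R then M else B) := by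
      refine Finset.sum_le_sum fun x _ => ?_
      split_ifs with hx
      · have h1 := ha x
        have h2 := ha (c - x)
        rcases (Finset.mem_filter.1 hx).2 with h | h <;> linarith
      · simp only [hR, Finset.mem_filter, Finset.mem_univ, true_and, not_or] at hx
        exact hB x hx.1 hx.2
    rw [Finset.sum_add_distrib, hinv, Finset.sum_ite, Finset.sum_const, Finset.sum_const] at hle
    have hf1 : (Finset.univ.filter fun x => x ∈ R) = R := by ext; simp
    have hf2 : ((Finset.univ.filter fun x => x ∉ R).card : ℤ) = Fintype.card ι - R.card := by
      have := Finset.card_compl_add_card R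
      have h' : (Finset.univ.filter fun x => x ∉ R) = Rᶜ := by ext; simp
      rw [h']
      omega
    rw [hf1, nsmul_eq_mul, nsmul_eq_mul, hf2] at hle
    linarith

lemma ncard_le_sum_layers {p n : ℕ} [Fact p.Prime] (hn : 1 ≤ n) (A : Set (Fin n → ZMod p))
    (v : Fin n → ZMod p) (K : Submodule (ZMod p) (Fin n → ZMod p))
    (hK : Module.finrank (ZMod p) K = n - 1) (hv : v ∉ K) :
    A.ncard ≤ ∑ i : ZMod p, (layerKL v K A i).ncard := by
  classical
  have htop : K ⊔ Submodule.span (ZMod p) {v} = ⊤ := by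
    apply Submodule.eq_top_of_finrank_eq
    have hlt : K < K ⊔ Submodule.span (ZMod p) {v} := by
      refine lt_of_le_of_ne le_sup_left fun h => hv ?_
      rw [h]
      exact Submodule.mem_sup_right (Submodule.mem_span_singleton_self v)
    have h1 := Submodule.finrank_lt_finrank_of_lt hlt
    have h2 := Submodule.finrank_le (K ⊔ Submodule.span (ZMod p) {v})
    have h3 : Module.finrank (ZMod p) (Fin n → ZMod p) = n := by simp
    omega
  have hsub : A ⊆ ⋃ i ∈ (Finset.univ : Finset (ZMod p)),
      (fun x => x + i • v) '' layerKL v K A i := by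
    intro x hx
    have hxt : x ∈ K ⊔ Submodule.span (ZMod p) {v} := htop ▸ Submodule.mem_top
    obtain ⟨y, hy, z, hz, rfl⟩ := Submodule.mem_sup.1 hxt
    obtain ⟨i, rfl⟩ := Submodule.mem_span_singleton.1 hz
    simp only [Finset.mem_univ, Set.iUnion_true, Set.mem_iUnion]
    exact ⟨i, y, ⟨hy, hx⟩, rfl⟩
  refine (Set.ncard_le_ncard hsub (Set.toFinite _)).trans ?_
  refine (Finset.set_ncard_biUnion_le _ _).trans ?_
  exact Finset.sum_le_sum fun i _ => Set.ncard_image_le (Set.toFinite _)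

lemma mul_card_addSubgroup_le_of_card_eq_prime_pow {G : Type*} [AddCommGroup G] [Fintype G]
    {p d : ℕ} (hp : p.Prime) (hG : Fintype.card G = p ^ d) (H : AddSubgroup G) (hH : H ≠ ⊤) :
    p * Nat.card H ≤ Fintype.card G := by
  have hdvd := H.card_addSubgroup_dvd_card
  rw [Nat.card_eq_fintype_card (α := G), hG] at hdvd
  obtain ⟨j, hj, hjc⟩ := (Nat.dvd_prime_pow hp).1 hdvd
  have hne : j ≠ d := by
    rintro rfl
    exact hH (AddSubgroup.eq_top_of_card_eq H (by rw [hjc, Nat.card_eq_fintype_card, hG]))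
  rw [hjc, hG, ← pow_succ']
  exact Nat.pow_le_pow_right hp.pos (by omega)

/-- If `k+ℓ ≥ 4`, `m ≥ 9+λ`, and `ω(A) > p - θ` under some
decomposition (`θ = k+ℓ+λ+2`), then the layer sizes of `A` are nearly balanced:
`Σ_{i ∈ F_p} ||A_i| - u| ≤ (2+θ)·p^(n-1)` for some `u ∈ ℕ`. -/
theorem stmt16 (k l n m lam p : ℕ) [NeZero p] (hlk : l < k) (hl : 1 ≤ l) (hkl : 4 ≤ k + l)
    (hn : 1 ≤ n) (hm : 9 + lam ≤ m) (hlam : lam ≤ k + l - 3)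
    (hp : p = (k + l) * m + 2 + lam) (hpp : p.Prime)
    (A : Set (Fin n → ZMod p)) (hA : A.Nonempty) (hfree : KLFree k l A)
    (hcard : m * p ^ (n - 1) ≤ A.ncard)
    (v : Fin n → ZMod p) (K : Submodule (ZMod p) (Fin n → ZMod p))
    (hK : Module.finrank (ZMod p) K = n - 1) (hv : v ∉ K)
    (hw : p - (k + l + lam + 2) < weight v K A) :
    ∃ u : ℕ, ∑ i : ZMod p, |((layerKL v K A i).ncard : ℤ) - (u : ℤ)| ≤
      (((2 + (k + l + lam + 2)) * p ^ (n - 1) : ℕ) : ℤ) := by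
  classical
  have : Fact p.Prime := ⟨hpp⟩
  set N := p ^ (n - 1)
  have hNpos : 0 < N := pow_pos hpp.pos _
  let L : ZMod p → Finset K := fun i =>
    Finset.univ.filter fun x => (x : Fin n → ZMod p) + i • v ∈ A
  have hL : ∀ i, (layerKL v K A i).ncard = (L i).card := by
    intro i
    have h1 : layerKL v K A i = (fun x : K => (x : Fin n → ZMod p)) '' (L i : Set K) := by
      ext x
      simp only [layerKL, L, Set.mem_ofPred_eq, Finset.coe_filter, Finset.mem_univ, true_and,
        Set.mem_image]
      constructor
      · rintro ⟨hx, h⟩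
        exact ⟨⟨x, hx⟩, h, rfl⟩
      · rintro ⟨y, h, rfl⟩
        exact ⟨y.2, h⟩
    rw [h1, Set.ncard_image_of_injective _ Subtype.val_injective, Set.ncard_coe_finset]
  have hKcard : Fintype.card K = N := by
    rw [Module.card_eq_pow_finrank (K := ZMod p) (V := K), hK, ZMod.card]
  have hq : ∀ H : AddSubgroup K, H ≠ ⊤ → p * Nat.card H ≤ Fintype.card K :=
    fun H hH => mul_card_addSubgroup_le_of_card_eq_prime_pow hpp hKcard H hH
  have htotal := ncard_le_sum_layers hn A v K hK hv
  simp only [hL] at htotal ⊢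
  obtain ⟨i₀, -, hmax⟩ := Finset.exists_max_image Finset.univ (fun i => (L i).card)
    Finset.univ_nonempty
  replace hmax : ∀ i, (L i).card ≤ (L i₀).card := fun i => hmax i (Finset.mem_univ i)
  set M := (L i₀).card
  have hθ : k + l + lam + 2 < p := by
    have : (k + l) * 9 ≤ (k + l) * m := Nat.mul_le_mul_left _ (by omega)
    omega
  have hsupp : supp v K A = ((Finset.univ.filter fun i => ¬ (L i).card = 0) : Finset (ZMod p)) := by
    ext i
    simp only [supp, Set.mem_ofPred_eq, Finset.coe_filter, Finset.mem_univ, true_and]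
    rw [← hL, Set.ncard_eq_zero (Set.toFinite _), Set.nonempty_iff_ne_empty]
  have hzero : (Finset.univ.filter fun i => (L i).card = 0).card ≤ k + l + lam + 1 := by
    have h1 := Finset.card_filter_add_card_filter_not (s := (Finset.univ : Finset (ZMod p)))
      (fun i => (L i).card = 0)
    rw [Finset.card_univ, ZMod.card] at h1
    rw [weight, hsupp, Set.ncard_coe_finset] at hw
    omega
  have hMpos : (L i₀).Nonempty := by
    rw [← Finset.card_pos]
    by_contra hcon
    have h0 : ∀ i, (L i).card = 0 := fun i => by have := hmax i; omega
    simp only [h0, Finset.card_univ, ZMod.card, Finset.filter_true] at hzero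
    omega
  obtain ⟨r, rfl⟩ : ∃ r, k = r + 2 := ⟨k - 2, by omega⟩
  obtain ⟨s, rfl⟩ : ∃ s, l = s + 1 := ⟨l - 1, by omega⟩
  set c : ZMod p := ((s + 1 : ℕ) : ZMod p) * i₀ - (r : ZMod p) * i₀ with hc
  have hpair : ∀ x, (L x).Nonempty → (L (c - x)).Nonempty →
      p * ((L x).card + (L (c - x)).card + (r + 1 + s) * M) ≤ p * N + (r + 1 + s) * N := by
    intro x hx hy
    rw [← hKcard]
    refine card_layers_le_of_disjoint p hq (L i₀) (L x) (L (c - x)) hMpos hx hy r s ?_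
    rw [Finset.disjoint_left]
    intro z hz hz'
    rw [add_comm (L x + L (c - x))] at hz
    obtain ⟨w, hw', yz, hyz, rfl⟩ := Finset.mem_add.1 hz
    obtain ⟨y₁, hy₁, y₂, hy₂, rfl⟩ := Finset.mem_add.1 hyz
    rw [← succ_nsmul'] at hz'
    have hmem : ∀ i, ∀ x ∈ L i, K.subtype.toAddMonoidHom x + i • v ∈ A := by
      intro i x hx
      exact (Finset.mem_filter.1 hx).2
    have hl' := add_nsmul_mem_itSum K.subtype.toAddMonoidHom (i₀ • v) A (L i₀) (hmem i₀) _ _ hz'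
    have hk' := add_nsmul_mem_itSum K.subtype.toAddMonoidHom (i₀ • v) A (L i₀) (hmem i₀) _ _ hw'
    have hk'' : K.subtype.toAddMonoidHom (w + (y₁ + y₂)) + (s + 1) • i₀ • v ∈ itSum (r + 2) A := by
      refine ⟨_, ⟨_, hk', _, hmem _ _ hy₁, rfl⟩, _, hmem _ _ hy₂, ?_⟩
      have hcv : (r : ZMod p) • i₀ • v + (x • v + (c - x) • v) =
          ((s + 1 : ℕ) : ZMod p) • i₀ • v := by
        simp only [smul_smul, ← add_smul]
        congr 1
        rw [hc]
        ring
      rw [Nat.cast_smul_eq_nsmul, Nat.cast_smul_eq_nsmul] at hcv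
      rw [← hcv]
      simp only [map_add]
      abel
    have hboth : _ ∈ itSum (r + 2) A ∩ itSum (s + 1) A := ⟨hk'', hl'⟩
    rw [hfree] at hboth
    exact hboth
  obtain ⟨ρ, hρ, hρsum⟩ := two_mul_sum_le_of_reflection (fun i => (p : ℤ) * (L i).card) c (p * M)
    (((p : ℤ) + (r + 1 + s)) * N - (r + 1 + s) * (p * M)) (r + 2 + (s + 1) + lam + 1)
    (fun x => by exact_mod_cast Nat.mul_le_mul_left p (hmax x))
    (by simpa [hpp.ne_zero] using hzero)
    (fun x hx hy => by
      have hx' : (L x).Nonempty := by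
        rw [← Finset.card_ne_zero]; intro h; exact hx (by simp [h])
      have hy' : (L (c - x)).Nonempty := by
        rw [← Finset.card_ne_zero]; intro h; exact hy (by simp [h])
      have h := hpair x hx' hy'
      zify at h
      linarith)
  rw [← Finset.mul_sum, ZMod.card] at hρsum
  have htot : ((m : ℤ) * N) ≤ ∑ i, ((L i).card : ℤ) := by exact_mod_cast hcard.trans htotal
  have hfinal := max_layer_bound (r + 2 + (s + 1)) m lam ρ p N M (by exact_mod_cast hkl)
    (by positivity) (by omega) (by exact_mod_cast hm) (by positivity) (by omega)
    (by exact_mod_cast hp) (by exact_mod_cast hNpos) (by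
      have := mul_le_mul_of_nonneg_left htot (show (0 : ℤ) ≤ 2 * p by positivity)
      linarith)
  refine ⟨M, ?_⟩
  have habs : ∀ i, |((L i).card : ℤ) - M| = M - (L i).card := by
    intro i
    have : ((L i).card : ℤ) ≤ M := by exact_mod_cast hmax i
    rw [abs_sub_comm, abs_of_nonneg (by linarith)]
  simp only [habs, Finset.sum_sub_distrib, Finset.sum_const, Finset.card_univ, ZMod.card,
    nsmul_eq_mul]
  push_cast
  linarith
end

section
/- Let k > ℓ ≥ 1 with k+ℓ ≥ 4 and 0 ≤ λ ≤ k+ℓ−3, let p = (k+ℓ)m+2+λ be prime, and let n ≥ 1. Assume m ≥ 9+λ and m ≥ (2+θ)·(1+1/(k+ℓ))·(k+ℓ)^{1/(k+ℓ−2)}, where θ = k+ℓ+λ+2. If A ⊆ F_p^n satisfies |A| ≥ m·p^{n−1} and ω(A) > p − θ under every decomposition (v,K) of F_p^n, then A is not (k,ℓ)-sum-free. -/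
open Pointwise

section CosetSums

variable {H : Type*} [AddCommGroup H] [Fintype H] [DecidableEq H] {q : ℕ}

/-- A weak form of Mann's theorem, for a summand containing zero. -/
theorem card_add_card_le_of_zero_mem (hq : ∀ L : AddSubgroup H, L ≠ ⊤ → Nat.card L ≤ q)
    (A B : Finset H) (hA : A.Nonempty) (hB : 0 ∈ B) (hAB : A + B ≠ Finset.univ) :
    A.card + B.card ≤ (A + B).card + q := by
  induction hn : B.card using Nat.strong_induction_on generalizing A B with
  | _ n ih =>
    subst hn
    by_cases hcl : ∀ a ∈ A, ∀ b ∈ B, a + b ∈ A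
    · set L := AddSubmonoid.closure (B : Set H) with hL
      have hAL : ∀ x ∈ L, ∀ a ∈ A, a + x ∈ A := by
        intro x hx
        induction hx using AddSubmonoid.closure_induction with
        | mem x hx => exact fun a ha => hcl a ha x hx
        | zero => simp
        | add x y _ _ hx hy =>
          intro a ha
          rw [← add_assoc]
          exact hy _ (hx a ha)
      let L' : AddSubgroup H :=
        { L with
          neg_mem' := by
            intro x hx
            have h1 : (addOrderOf x - 1) • x ∈ L := L.nsmul_mem hx _
            have h2 : -x = (addOrderOf x - 1) • x := by
              have h3 : addOrderOf x • x = 0 := addOrderOf_nsmul_eq_zero x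
              have h4 : 0 < addOrderOf x := addOrderOf_pos x
              obtain ⟨t, ht⟩ : ∃ t, addOrderOf x = t + 1 := ⟨addOrderOf x - 1, by omega⟩
              rw [ht, succ_nsmul] at h3
              rw [ht, Nat.add_sub_cancel]
              exact (eq_neg_of_add_eq_zero_left h3).symm
            change -x ∈ L
            rw [h2]
            exact h1 }
      have hL' : L' ≠ ⊤ := by
        intro htop
        apply hAB
        obtain ⟨a, ha⟩ := hA
        rw [Finset.eq_univ_iff_forall]
        intro x
        have hx : x - a ∈ L' := by rw [htop]; trivial
        have := hAL (x - a) hx a ha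
        rw [add_sub_cancel] at this
        simpa using Finset.add_mem_add this hB
      have h1 : B.card ≤ Nat.card L' := by
        rw [← Set.ncard_coe_finset, ← Nat.card_coe_set_eq]
        exact Nat.card_mono (Set.toFinite _) (AddSubmonoid.subset_closure)
      have h2 : A.card ≤ (A + B).card := Finset.card_le_card (Finset.subset_add_left A hB)
      have h3 := hq L' hL'
      omega
    · push Not at hcl
      obtain ⟨e, he, b, hb, heb⟩ := hcl
      have hcard := Finset.addDysonETransform.card e (A, B)
      have hsub := Finset.addDysonETransform.subset e (A, B)
      simp only [Finset.addDysonETransform] at hcard hsub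
      have hlt : (B ∩ (-e +ᵥ A)).card < B.card := by
        apply Finset.card_lt_card
        refine ⟨Finset.inter_subset_left, fun h => heb ?_⟩
        have := (Finset.mem_inter.1 (h hb)).2
        rwa [Finset.mem_neg_vadd_finset_iff, vadd_eq_add] at this
      have h0 : (0 : H) ∈ B ∩ (-e +ᵥ A) := by
        rw [Finset.mem_inter, Finset.mem_neg_vadd_finset_iff, vadd_eq_add, add_zero]
        exact ⟨hB, he⟩
      have hne : (A ∪ (e +ᵥ B)) + (B ∩ (-e +ᵥ A)) ≠ Finset.univ := by
        intro h
        rw [h] at hsub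
        exact hAB (Finset.univ_subset_iff.1 hsub)
      have := ih _ hlt _ _ (hA.mono Finset.subset_union_left) h0 hne rfl
      have hle := Finset.card_le_card hsub
      omega

/-- A weak form of Mann's theorem: if `A + B` is not the whole group and all proper subgroups
have at most `q` elements, then `|A + B| ≥ |A| + |B| - q`. -/
theorem card_add_card_le_of_add_ne_univ
    (hq : ∀ L : AddSubgroup H, L ≠ ⊤ → Nat.card L ≤ q)
    (A B : Finset H) (hA : A.Nonempty) (hB : B.Nonempty) (hAB : A + B ≠ Finset.univ) :
    A.card + B.card ≤ (A + B).card + q := by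
  obtain ⟨b, hb⟩ := hB
  have h1 : A + (-b +ᵥ B) = -b +ᵥ (A + B) := add_vadd_comm _ _ _
  have := card_add_card_le_of_zero_mem hq A (-b +ᵥ B) hA
    (by rw [Finset.mem_neg_vadd_finset_iff]; simpa using hb)
    (by
      rw [h1]
      intro h
      apply hAB
      rw [Finset.eq_univ_iff_forall] at h ⊢
      intro x
      have := h (-b + x)
      rw [Finset.mem_neg_vadd_finset_iff] at this
      simpa using this)
  rwa [h1, Finset.card_vadd_finset, Finset.card_vadd_finset] at this

theorem card_add_nsmul_card_le (hq : ∀ L : AddSubgroup H, L ≠ ⊤ → Nat.card L ≤ q)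
    (X D : Finset H) (hX : X.Nonempty) (hD : D.Nonempty) (j : ℕ)
    (h : X + j • D ≠ Finset.univ) :
    X.card + j * D.card ≤ (X + j • D).card + j * q := by
  induction j with
  | zero => simp
  | succ j ih =>
    rw [succ_nsmul, ← add_assoc] at h ⊢
    have hj : X + j • D ≠ Finset.univ := by
      intro h'
      apply h
      obtain ⟨d, hd⟩ := hD
      rw [h', Finset.eq_univ_iff_forall]
      exact fun x => Finset.mem_add.2 ⟨x - d, Finset.mem_univ _, d, hd, sub_add_cancel _ _⟩
    have h1 := ih hj
    have h2 := card_add_card_le_of_add_ne_univ hq (X + j • D) D (hX.add hD.nsmul) hD h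
    linarith

theorem card_le_of_disjoint_sums (hq : ∀ L : AddSubgroup H, L ≠ ⊤ → Nat.card L ≤ q)
    (X Y D : Finset H) (hX : X.Nonempty) (hY : Y.Nonempty) (hD : D.Nonempty) (i j : ℕ)
    (h : Disjoint (X + i • D) (Y + j • D)) :
    X.card + Y.card + (i + j) * D.card ≤ Fintype.card H + (i + j) * q := by
  have hdis : Disjoint (X + i • D + j • (-D)) Y := by
    rw [Finset.disjoint_left]
    intro y hy hyY
    obtain ⟨x, hx, e, he, rfl⟩ := Finset.mem_add.1 hy
    rw [neg_nsmul, Finset.mem_neg'] at he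
    refine Finset.disjoint_left.1 h hx ?_
    have := Finset.add_mem_add hyY he
    simpa using this
  have hne : X + i • D + j • (-D) ≠ Finset.univ := by
    intro h'
    rw [h'] at hdis
    obtain ⟨y, hy⟩ := hY
    exact Finset.disjoint_left.1 hdis (Finset.mem_univ y) hy
  have hne' : X + i • D ≠ Finset.univ := by
    intro h'
    rw [h'] at h
    obtain ⟨y, hy⟩ := hY.add (hD.nsmul (n := j))
    exact Finset.disjoint_left.1 h (Finset.mem_univ y) hy
  have h1 := card_add_nsmul_card_le hq X D hX hD i hne'
  have h2 := card_add_nsmul_card_le hq (X + i • D) (-D) (hX.add hD.nsmul) hD.neg j hne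
  have h3 := Finset.card_le_univ ((X + i • D + j • (-D)) ∪ Y)
  rw [Finset.card_union_of_disjoint hdis] at h3
  rw [Finset.card_neg] at h2
  linarith

end CosetSums

theorem mul_sup_le_sum_add {ι : Type*} [Fintype ι] (f : ι → ℕ) (σ : Equiv.Perm ι)
    {j m lam κ q M : ℕ} (hj : 2 ≤ j) (hlam : lam + 1 ≤ j) (hm : j + lam + 6 ≤ m) (hm' : 9 ≤ m)
    (hκ : 0 < κ) (hcard : Fintype.card ι = (j + 2) * m + 2 + lam)
    (hq : Fintype.card ι * q ≤ κ) (hM : ∀ i, f i ≤ M)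
    (hzero : (Finset.univ.filter fun i => f i = 0).card ≤ j + lam + 3)
    (h : ∀ x, 0 < f x → 0 < f (σ x) → f x + f (σ x) + j * M ≤ κ + j * q)
    (hS : m * κ ≤ ∑ i, f i) :
    Fintype.card ι * M ≤ ∑ i, f i + 3 * κ := by
  classical
  set p := Fintype.card ι with hp
  set S := ∑ i, f i with hSdef
  set Z := Finset.univ.filter fun i => f i = 0 with hZ
  set b := (Z ∪ Z.image σ.symm).card with hb
  have hb2 : b ≤ 2 * (j + lam + 3) := by
    have h1 := Finset.card_union_le Z (Z.image σ.symm)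
    have h2 : (Z.image σ.symm).card ≤ Z.card := Finset.card_image_le
    omega
  have hsum : (2 * S : ℤ) ≤ p * (κ + j * q - j * M) + b * ((j + 1) * M - (κ + j * q)) := by
    have h1 : (2 * S : ℤ) = ∑ i, ((f i : ℤ) + f (σ i)) := by
      rw [Finset.sum_add_distrib, Equiv.sum_comp σ (fun i => (f i : ℤ)), hSdef]
      push_cast
      ring
    have h2 : ∀ i, (f i : ℤ) + f (σ i) ≤ (κ + j * q - j * M) +
        if i ∈ Z ∪ Z.image σ.symm then ((j + 1) * M - (κ + j * q) : ℤ) else 0 := by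
      intro i
      have hi := hM i
      have hi' := hM (σ i)
      split_ifs with hmem
      · have : f i = 0 ∨ f (σ i) = 0 := by
          rcases Finset.mem_union.1 hmem with hmem | hmem
          · left
            simpa [hZ] using hmem
          · right
            obtain ⟨y, hy, rfl⟩ := Finset.mem_image.1 hmem
            simpa [hZ] using hy
        have : f i + f (σ i) ≤ M := by omega
        have : ((f i + f (σ i) : ℕ) : ℤ) ≤ M := by exact_mod_cast this
        push_cast at this
        linarith
      · have h3 : f i ≠ 0 := fun h0 => hmem (Finset.mem_union_left _ (by simpa [hZ] using h0))
        have h4 : f (σ i) ≠ 0 := fun h0 => hmem (Finset.mem_union_right _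
          (Finset.mem_image.2 ⟨σ i, by simpa [hZ] using h0, by simp⟩))
        have := h i (Nat.pos_of_ne_zero h3) (Nat.pos_of_ne_zero h4)
        have : ((f i + f (σ i) + j * M : ℕ) : ℤ) ≤ (κ + j * q : ℕ) := by exact_mod_cast this
        push_cast at this
        linarith
    rw [h1]
    refine (Finset.sum_le_sum fun i _ => h2 i).trans (le_of_eq ?_)
    rw [Finset.sum_add_distrib, Finset.sum_ite_mem, Finset.univ_inter, Finset.sum_const,
      Finset.sum_const, Finset.card_univ, nsmul_eq_mul, nsmul_eq_mul]
  zify at *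
  have hpQ : (p : ℤ) * (κ + j * q) ≤ κ * (p + j) := by nlinarith
  by_cases hc : ((j + 1) * M - (κ + j * q) : ℤ) ≤ 0
  · have h1 : (b : ℤ) * ((j + 1) * M - (κ + j * q)) ≤ 0 :=
      mul_nonpos_of_nonneg_of_nonpos (by positivity) hc
    have h2 : (j : ℤ) * (p * M - S) ≤ j * (3 * κ) := by
      have h3 : (j + 2 : ℤ) * (m * κ) ≤ (j + 2) * S := by gcongr
      have h4 : (κ : ℤ) * (2 + lam + j) ≤ κ * (3 * j) := by
        gcongr
        linarith
      have h5 : (κ : ℤ) * (p + j) = (j + 2) * (m * κ) + κ * (2 + lam + j) := by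
        rw [hcard]; ring
      linarith
    have := le_of_mul_le_mul_left h2 (by linarith)
    linarith
  · push Not at hc
    exfalso
    have h1 : (b : ℤ) * ((j + 1) * M - (κ + j * q)) ≤
        (2 * (j + lam + 3)) * ((j + 1) * M - (κ + j * q)) := by gcongr
    have h2 : (2 * (j + lam + 3) : ℤ) * (j + 1) - j * p ≤ 0 := by
      rw [hcard]; nlinarith
    have h3 := mul_nonpos_of_nonpos_of_nonneg h2 hc.le
    have h4 : (2 * S : ℤ) * (j + 1) ≤ κ * (p + j) := by nlinarith
    have h5 : (2 * (m * κ) : ℤ) * (j + 1) ≤ 2 * S * (j + 1) := by gcongr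
    have h6 : (κ : ℤ) * (2 * m * (j + 1)) ≤ κ * (p + j) := by linarith
    have h7 := le_of_mul_le_mul_left h6 hκ
    rw [hcard] at h7
    nlinarith

theorem itSum_eq_nsmul {G : Type*} [AddCommMonoid G] (h : ℕ) (A : Set G) : itSum h A = h • A := by
  induction h with
  | zero => simp [itSum, Set.singleton_zero]
  | succ h ih => rw [itSum, ih, succ_nsmul]

theorem mul_card_addSubgroup_le {p d : ℕ} (hp : p.Prime) {H : Type*} [AddCommGroup H]
    (hH : Nat.card H = p ^ d) (L : AddSubgroup H) (hL : L ≠ ⊤) : p * Nat.card L ≤ p ^ d := by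
  have h1 := L.card_mul_index
  rw [hH] at h1
  obtain ⟨i, -, hi⟩ := (Nat.dvd_prime_pow hp).1 (Dvd.intro_left _ h1)
  have h2 : i ≠ 0 := by
    rintro rfl
    exact hL (AddSubgroup.index_eq_one.1 (by simpa using hi))
  have h3 : p ≤ L.index := by
    rw [hi]
    exact Nat.le_self_pow h2 p
  rw [← h1, mul_comm]
  gcongr

section Layers

variable {p n : ℕ} [Fact p.Prime] (φ : (Fin n → ZMod p) →ₗ[ZMod p] ZMod p) (v : Fin n → ZMod p)
  (A : Finset (Fin n → ZMod p))

open Classical in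
/-- The layer of `A` over `i`, as a finite subset of the kernel of the linear form `φ`. -/
noncomputable def kerLayer (i : ZMod p) : Finset (LinearMap.ker φ) :=
  Finset.univ.filter fun x => (x : Fin n → ZMod p) + i • v ∈ A

variable {φ v A}

theorem mem_kerLayer {i : ZMod p} {x : LinearMap.ker φ} :
    x ∈ kerLayer φ v A i ↔ (x : Fin n → ZMod p) + i • v ∈ A := by
  simp [kerLayer]

theorem card_kerLayer (hv : φ v = 1) (i : ZMod p) :
    (kerLayer φ v A i).card = (A.filter fun x => φ x = i).card := by
  refine Finset.card_bij (fun x _ => (x : Fin n → ZMod p) + i • v) ?_ ?_ ?_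
  · intro x hx
    rw [mem_kerLayer] at hx
    have : φ x = 0 := x.2
    simp [hx, this, hv]
  · intro x _ y _ h
    exact Subtype.ext (add_right_cancel h)
  · intro y hy
    obtain ⟨hyA, hyi⟩ := Finset.mem_filter.1 hy
    refine ⟨⟨y - i • v, ?_⟩, ?_, ?_⟩
    · rw [LinearMap.mem_ker]
      simp [hyi, hv]
    · rw [mem_kerLayer]
      simpa using hyA
    · simp

theorem finrank_ker_eq (hv : φ v = 1) : Module.finrank (ZMod p) (LinearMap.ker φ) = n - 1 := by
  have h1 := LinearMap.finrank_range_add_finrank_ker φ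
  have h2 : LinearMap.range φ = ⊤ := by
    rw [LinearMap.range_eq_top]
    exact fun c => ⟨c • v, by simp [hv]⟩
  rw [h2, finrank_top, Module.finrank_self, Module.finrank_fin_fun] at h1
  omega

theorem add_nsmul_mem_of_mem_nsmul_kerLayer [DecidableEq (LinearMap.ker φ)] {c : ZMod p} {j : ℕ}
    {d : LinearMap.ker φ} (hd : d ∈ j • kerLayer φ v A c) :
    (d : Fin n → ZMod p) + (j * c) • v ∈ j • (A : Set (Fin n → ZMod p)) := by
  induction j generalizing d with
  | zero => simpa using hd
  | succ j ih =>
    rw [succ_nsmul] at hd ⊢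
    obtain ⟨x, hx, y, hy, rfl⟩ := Finset.mem_add.1 hd
    refine Set.mem_add.2 ⟨_, ih hx, _, mem_kerLayer.1 hy, ?_⟩
    push_cast
    module

theorem card_filter_add_card_filter_le (hv : φ v = 1) {i j : ℕ}
    (hfree : KLFree (i + 1) (j + 1) (A : Set (Fin n → ZMod p))) {x y c : ZMod p}
    (hxy : x + i * c = y + j * c)
    (hx : 0 < (A.filter fun a => φ a = x).card) (hy : 0 < (A.filter fun a => φ a = y).card)
    (hc : 0 < (A.filter fun a => φ a = c).card) :
    (A.filter fun a => φ a = x).card + (A.filter fun a => φ a = y).card +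
      (i + j) * (A.filter fun a => φ a = c).card ≤ p ^ (n - 1) + (i + j) * (p ^ (n - 1) / p) := by
  classical
  have hp : p.Prime := Fact.out
  have hK : Nat.card (LinearMap.ker φ) = p ^ (n - 1) := by
    rw [Module.natCard_eq_pow_finrank (K := ZMod p), finrank_ker_eq hv, Nat.card_zmod]
  rw [← card_kerLayer hv] at hx hy hc
  rw [← card_kerLayer hv, ← card_kerLayer hv, ← card_kerLayer hv]
  have := card_le_of_disjoint_sums (q := p ^ (n - 1) / p) (fun L hL => by
      rw [Nat.le_div_iff_mul_le hp.pos, mul_comm]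
      exact mul_card_addSubgroup_le hp hK L hL)
    (kerLayer φ v A x) (kerLayer φ v A y) (kerLayer φ v A c) (Finset.card_pos.1 hx)
    (Finset.card_pos.1 hy) (Finset.card_pos.1 hc) i j ?_
  · rwa [Fintype.card_eq_nat_card, hK] at this
  · have key : ∀ (i : ℕ) (x : ZMod p), ∀ z ∈ kerLayer φ v A x + i • kerLayer φ v A c,
        (z : Fin n → ZMod p) + (x + i * c) • v ∈ itSum (i + 1) (A : Set (Fin n → ZMod p)) := by
      intro i x z hz
      rw [itSum_eq_nsmul, succ_nsmul']
      obtain ⟨s, hs, t, ht, rfl⟩ := Finset.mem_add.1 hz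
      refine Set.mem_add.2 ⟨_, mem_kerLayer.1 hs, _, add_nsmul_mem_of_mem_nsmul_kerLayer ht, ?_⟩
      push_cast
      module
    rw [Finset.disjoint_left]
    intro z hz hz'
    have h1 := key i x z hz
    have h2 := key j y z hz'
    rw [← hxy] at h2
    have : _ ∈ itSum (i + 1) _ ∩ itSum (j + 1) (A : Set (Fin n → ZMod p)) := ⟨h1, h2⟩
    rw [KLFree] at hfree
    rw [hfree] at this
    exact this

theorem supp_ker_eq (hv : φ v = 1) :
    supp v (LinearMap.ker φ) (A : Set (Fin n → ZMod p)) =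
      {i | (A.filter fun a => φ a = i).card ≠ 0} := by
  ext i
  rw [Set.mem_ofPred_eq, ← card_kerLayer hv, Finset.card_ne_zero]
  constructor
  · rintro ⟨x, hx, hxA⟩
    exact ⟨⟨x, hx⟩, mem_kerLayer.2 hxA⟩
  · rintro ⟨x, hx⟩
    exact ⟨x, x.2, mem_kerLayer.1 hx⟩

end Layers

section Fourier

variable {p n : ℕ} [Fact p.Prime]

/-- The Fourier coefficient of the indicator function of `A` at the frequency `w`. -/
noncomputable def indFourier (A : Finset (Fin n → ZMod p)) (w : Fin n → ZMod p) : ℂ :=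
  ∑ a ∈ A, ZMod.stdAddChar (w ⬝ᵥ a)

theorem sum_stdAddChar_dotProduct (x : Fin n → ZMod p) :
    ∑ w : Fin n → ZMod p, ZMod.stdAddChar (w ⬝ᵥ x) = if x = 0 then (p ^ n : ℂ) else 0 := by
  split_ifs with hx
  · subst hx
    simp [ZMod.card]
  · obtain ⟨i, hi⟩ := Function.ne_iff.1 hx
    let ψ : AddChar (Fin n → ZMod p) ℂ := ZMod.stdAddChar.compAddMonoidHom
      { toFun := fun w => w ⬝ᵥ x, map_zero' := zero_dotProduct x
        map_add' := fun u w => add_dotProduct u w x }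
    change ∑ w, ψ w = 0
    rw [AddChar.sum_eq_zero_iff_ne_zero]
    intro h
    have h1 : ψ (Pi.single i 1) = 1 := by rw [h]; rfl
    have h2 : ZMod.stdAddChar (Pi.single i 1 ⬝ᵥ x) = ZMod.stdAddChar (0 : ZMod p) := by
      rw [AddChar.map_zero_eq_one]
      exact h1
    have h3 := ZMod.injective_stdAddChar h2
    rw [single_one_dotProduct] at h3
    exact hi h3

theorem indFourier_pow (A : Finset (Fin n → ZMod p)) (w : Fin n → ZMod p) (k : ℕ) :
    indFourier A w ^ k = ∑ x ∈ Fintype.piFinset fun _ : Fin k => A,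
      ZMod.stdAddChar (w ⬝ᵥ ∑ i, x i) := by
  rw [indFourier, Finset.sum_pow']
  refine Finset.sum_congr rfl fun x _ => ?_
  rw [dotProduct_sum]
  exact (map_prod (ZMod.stdAddChar (N := p)).toMonoidHom
    (fun i => Multiplicative.ofAdd (w ⬝ᵥ x i)) Finset.univ).symm

theorem conj_indFourier_pow (A : Finset (Fin n → ZMod p)) (w : Fin n → ZMod p) (l : ℕ) :
    (starRingEnd ℂ) (indFourier A w) ^ l = ∑ x ∈ Fintype.piFinset fun _ : Fin l => A,
      ZMod.stdAddChar (w ⬝ᵥ -∑ i, x i) := by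
  rw [← map_pow, indFourier_pow, map_sum]
  refine Finset.sum_congr rfl fun x _ => ?_
  rw [dotProduct_neg, AddChar.map_neg_eq_conj]

theorem sum_indFourier_pow_mul_conj_pow (A : Finset (Fin n → ZMod p)) (k l : ℕ) :
    ∑ w, indFourier A w ^ k * (starRingEnd ℂ) (indFourier A w) ^ l =
      ∑ x ∈ Fintype.piFinset fun _ : Fin k => A, ∑ y ∈ Fintype.piFinset fun _ : Fin l => A,
        if ∑ i, x i = ∑ i, y i then (p ^ n : ℂ) else 0 := by
  simp_rw [indFourier_pow, conj_indFourier_pow, Finset.sum_mul_sum]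
  rw [Finset.sum_comm]
  refine Finset.sum_congr rfl fun x _ => ?_
  rw [Finset.sum_comm]
  refine Finset.sum_congr rfl fun y _ => ?_
  simp_rw [← AddChar.map_add_eq_mul, ← dotProduct_add, ← sub_eq_add_neg]
  rw [sum_stdAddChar_dotProduct]
  simp only [sub_eq_zero]

theorem sum_norm_indFourier_sq (A : Finset (Fin n → ZMod p)) :
    ∑ w, ‖indFourier A w‖ ^ 2 = (p ^ n * A.card : ℝ) := by
  have h1 : ∑ w, indFourier A w * (starRingEnd ℂ) (indFourier A w) =
      ∑ x ∈ A, ∑ y ∈ A, if x = y then (p ^ n : ℂ) else 0 := by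
    simp_rw [indFourier, map_sum, Finset.sum_mul_sum]
    rw [Finset.sum_comm]
    refine Finset.sum_congr rfl fun x _ => ?_
    rw [Finset.sum_comm]
    refine Finset.sum_congr rfl fun y _ => ?_
    simp_rw [← AddChar.map_neg_eq_conj, ← AddChar.map_add_eq_mul, ← sub_eq_add_neg,
      ← dotProduct_sub]
    rw [sum_stdAddChar_dotProduct]
    simp only [sub_eq_zero]
  have h2 : ∑ x ∈ A, ∑ y ∈ A, (if x = y then (p ^ n : ℂ) else 0) = p ^ n * A.card := by
    simp [mul_comm]
  rw [h2] at h1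
  simp_rw [Complex.mul_conj'] at h1
  exact_mod_cast h1

theorem KLFree.sum_indFourier_eq_zero {k l : ℕ} {A : Finset (Fin n → ZMod p)}
    (hfree : KLFree k l (A : Set (Fin n → ZMod p))) :
    ∑ w, indFourier A w ^ k * (starRingEnd ℂ) (indFourier A w) ^ l = 0 := by
  have key : ∀ (k : ℕ) (x : Fin k → Fin n → ZMod p), x ∈ Fintype.piFinset (fun _ : Fin k => A) →
      ∑ i, x i ∈ itSum k (A : Set (Fin n → ZMod p)) := by
    intro k x hx
    rw [itSum_eq_nsmul]
    have := Set.finsetSum_mem_finsetSum Finset.univ (fun _ : Fin k => (A : Set (Fin n → ZMod p)))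
      x (fun i _ => Fintype.mem_piFinset.1 hx i)
    simpa using this
  rw [sum_indFourier_pow_mul_conj_pow]
  refine Finset.sum_eq_zero fun x hx => Finset.sum_eq_zero fun y hy => if_neg fun h => ?_
  have h1 := key k x hx
  have h2 := key l y hy
  rw [← h] at h2
  rw [KLFree] at hfree
  have : ∑ i, x i ∈ itSum k (A : Set (Fin n → ZMod p)) ∩ itSum l A := ⟨h1, h2⟩
  rw [hfree] at this
  exact this

theorem KLFree.card_pow_le {k l j : ℕ} (hj : k + l = j + 2) {A : Finset (Fin n → ZMod p)}
    (hfree : KLFree k l (A : Set (Fin n → ZMod p))) {B : ℝ} (hB0 : 0 ≤ B)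
    (hB : ∀ w ≠ 0, ‖indFourier A w‖ ≤ B) :
    (A.card : ℝ) ^ (j + 2) ≤ B ^ j * (p ^ n * A.card) := by
  classical
  have h0 := hfree.sum_indFourier_eq_zero
  rw [← Finset.add_sum_erase _ _ (Finset.mem_univ 0)] at h0
  have h1 : indFourier A 0 = A.card := by simp [indFourier]
  rw [h1, Complex.conj_natCast, ← pow_add, hj] at h0
  have h2 := congrArg norm (eq_neg_of_add_eq_zero_left h0)
  rw [norm_neg, norm_pow, Complex.norm_natCast] at h2
  rw [h2, ← sum_norm_indFourier_sq, Finset.mul_sum]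
  refine (norm_sum_le _ _).trans ?_
  have hle : ∀ w ∈ Finset.univ.erase (0 : Fin n → ZMod p),
      ‖indFourier A w ^ k * (starRingEnd ℂ) (indFourier A w) ^ l‖ ≤
        B ^ j * ‖indFourier A w‖ ^ 2 := by
    intro w hw
    rw [norm_mul, norm_pow, norm_pow, RCLike.norm_conj, ← pow_add, hj, pow_add]
    gcongr
    exact hB w (Finset.ne_of_mem_erase hw)
  refine (Finset.sum_le_sum hle).trans ?_
  exact Finset.sum_le_sum_of_subset_of_nonneg (Finset.erase_subset _ _)
    fun w _ _ => by positivity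

theorem norm_indFourier_le {A : Finset (Fin n → ZMod p)} {w : Fin n → ZMod p}
    {M : ℕ} (hM : ∀ i, (A.filter fun a => w ⬝ᵥ a = i).card ≤ M) :
    ‖indFourier A w‖ ≤ p * M - A.card := by
  have hprim : ∑ i : ZMod p, ZMod.stdAddChar i = (0 : ℂ) := by
    rw [AddChar.sum_eq_zero_iff_ne_zero]
    intro h
    have h1 : ZMod.stdAddChar (1 : ZMod p) = ZMod.stdAddChar (0 : ZMod p) := by rw [h]; rfl
    exact one_ne_zero (ZMod.injective_stdAddChar h1)
  have h1 : indFourier A w =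
      -∑ i : ZMod p, ((M : ℂ) - (A.filter fun a => w ⬝ᵥ a = i).card) * ZMod.stdAddChar i := by
    simp_rw [sub_mul]
    rw [Finset.sum_sub_distrib, ← Finset.mul_sum, hprim, mul_zero, zero_sub, neg_neg,
      indFourier, ← Finset.sum_fiberwise A (fun a => w ⬝ᵥ a)]
    refine Finset.sum_congr rfl fun i _ => ?_
    rw [Finset.sum_congr rfl (g := fun _ => ZMod.stdAddChar i)
      (fun a ha => by rw [(Finset.mem_filter.1 ha).2]), Finset.sum_const, nsmul_eq_mul]
  rw [h1, norm_neg]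
  refine (norm_sum_le _ _).trans (le_of_eq ?_)
  have h2 : ∀ i : ZMod p,
      ‖((M : ℂ) - (A.filter fun a => w ⬝ᵥ a = i).card) * ZMod.stdAddChar i‖ =
        (M : ℝ) - (A.filter fun a => w ⬝ᵥ a = i).card := by
    intro i
    rw [norm_mul, AddChar.norm_apply, mul_one, ← Nat.cast_sub (hM i), Complex.norm_natCast,
      Nat.cast_sub (hM i)]
  simp_rw [h2]
  rw [Finset.sum_sub_distrib, Finset.sum_const, Finset.card_univ, ZMod.card, nsmul_eq_mul,
    ← Nat.cast_sum]
  congr 2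
  exact (Finset.card_eq_sum_card_fiberwise fun _ _ => Finset.mem_coe.2 (Finset.mem_univ _)).symm

end Fourier

/-- If `|A| ≥ m·p^(n-1)` and `ω(A) > p - θ` under every decomposition
(`θ = k+ℓ+λ+2`), with `m ≥ 9+λ` and `m ≥ (2+θ)(1+1/(k+ℓ))(k+ℓ)^(1/(k+ℓ-2))`, then `A` is
not `(k,ℓ)`-sum-free. -/
theorem stmt18 (k l n m lam p : ℕ) (hlk : l < k) (hl : 1 ≤ l) (hkl : 4 ≤ k + l)
    (hn : 1 ≤ n) (hlam : lam ≤ k + l - 3)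
    (hp : p = (k + l) * m + 2 + lam) (hpp : p.Prime)
    (hm1 : 9 + lam ≤ m)
    (hm2 : ((2 + (k + l + lam + 2) : ℕ) : ℝ) * (1 + 1 / (k + l : ℝ)) *
        ((k + l : ℕ) : ℝ) ^ ((1 : ℝ) / ((k + l - 2 : ℕ) : ℝ)) ≤ (m : ℝ))
    (A : Set (Fin n → ZMod p)) (hcard : m * p ^ (n - 1) ≤ A.ncard)
    (hw : ∀ (v : Fin n → ZMod p) (K : Submodule (ZMod p) (Fin n → ZMod p)),
      Module.finrank (ZMod p) K = n - 1 → v ∉ K →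
        p - (k + l + lam + 2) < weight v K A) :
    ¬ KLFree k l A := by
  have : Fact p.Prime := ⟨hpp⟩
  intro hfree
  lift A to Finset (Fin n → ZMod p) using Set.toFinite A
  rw [Set.ncard_coe_finset] at hcard
  obtain ⟨j, hj⟩ : ∃ j, k + l = j + 2 := ⟨k + l - 2, by omega⟩
  have hmθ : j + lam + 6 ≤ m := by
    have h1 : (1 : ℝ) ≤ 1 + 1 / (k + l : ℝ) := le_add_of_nonneg_right (by positivity)
    have h2 : (1 : ℝ) ≤ ((k + l : ℕ) : ℝ) ^ ((1 : ℝ) / ((k + l - 2 : ℕ) : ℝ)) :=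
      Real.one_le_rpow (by exact_mod_cast (by omega : 1 ≤ k + l)) (by positivity)
    have h3 : ((2 + (k + l + lam + 2) : ℕ) : ℝ) ≤ m := by
      refine le_trans ?_ hm2
      rw [mul_assoc]
      exact le_mul_of_one_le_right (by positivity) (one_le_mul_of_one_le_of_one_le h1 h2)
    have h4 : 2 + (k + l + lam + 2) ≤ m := by exact_mod_cast h3
    omega
  rw [hj] at hp
  have hκ : 0 < p ^ (n - 1) := pow_pos hpp.pos _
  have hbias : ∀ w : Fin n → ZMod p, w ≠ 0 →
      ‖indFourier A w‖ ≤ 3 * (p ^ (n - 1) : ℕ) := by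
    intro w hw0
    obtain ⟨i₀, hi₀⟩ := Function.ne_iff.1 hw0
    let φ : (Fin n → ZMod p) →ₗ[ZMod p] ZMod p := dotProductBilin (ZMod p) (ZMod p) w
    have hv : φ (Pi.single i₀ (w i₀)⁻¹) = 1 := by
      change w ⬝ᵥ Pi.single i₀ (w i₀)⁻¹ = 1
      rw [dotProduct_single]
      exact mul_inv_cancel₀ hi₀
    set f : ZMod p → ℕ := fun i => (A.filter fun a => φ a = i).card with hf
    have hsum : A.card = ∑ i, f i :=
      Finset.card_eq_sum_card_fiberwise fun _ _ => Finset.mem_coe.2 (Finset.mem_univ _)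
    obtain ⟨c, -, hc⟩ := Finset.exists_max_image Finset.univ f Finset.univ_nonempty
    have hfc : 0 < f c := by
      rw [Nat.pos_iff_ne_zero]
      intro h0
      have h1 : ∑ i, f i = 0 := Finset.sum_eq_zero fun i hi => by
        have := hc i hi
        omega
      rw [← hsum] at h1
      rw [h1] at hcard
      have : 0 < m * p ^ (n - 1) := Nat.mul_pos (by omega) hκ
      omega
    have hzero : (Finset.univ.filter fun i => f i = 0).card ≤ j + lam + 3 := by
      have h1 := hw _ _ (finrank_ker_eq hv) (fun h => by
        rw [LinearMap.mem_ker, hv] at h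
        exact one_ne_zero h)
      have h2 : weight (Pi.single i₀ (w i₀)⁻¹) (LinearMap.ker φ) (A : Set (Fin n → ZMod p)) =
          (Finset.univ.filter fun i => ¬ f i = 0).card := by
        rw [weight, supp_ker_eq hv, ← Set.ncard_coe_finset]
        congr 1
        ext i
        simp [hf]
      have h3 := Finset.card_filter_add_card_filter_not (s := (Finset.univ : Finset (ZMod p)))
        (fun i => f i = 0)
      rw [Finset.card_univ, ZMod.card] at h3
      rw [h2] at h1
      omega
    have hmain := mul_sup_le_sum_add f (Equiv.addRight (((k : ZMod p) - l) * c)) (j := j)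
      (m := m) (lam := lam) (κ := p ^ (n - 1)) (q := p ^ (n - 1) / p) (M := f c)
      (by omega) (by omega) hmθ (by omega) hκ (by rw [ZMod.card]; exact hp)
      (by rw [ZMod.card]; exact Nat.mul_div_le _ _) (fun i => hc i (Finset.mem_univ i)) hzero
      (fun x hx hy => by
        obtain ⟨k, rfl⟩ : ∃ t, k = t + 1 := ⟨k - 1, by omega⟩
        obtain ⟨l, rfl⟩ : ∃ t, l = t + 1 := ⟨l - 1, by omega⟩
        have hkl' : j = k + l := by omega
        rw [hkl']
        refine card_filter_add_card_filter_le hv hfree ?_ hx hy hfc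
        rw [Equiv.coe_addRight]
        push_cast
        ring)
      (by rw [← hsum]; exact hcard)
    have hnorm := norm_indFourier_le (M := f c) fun i => hc i (Finset.mem_univ i)
    rw [ZMod.card, ← hsum] at hmain
    have : ((p * f c : ℕ) : ℝ) ≤ (A.card + 3 * p ^ (n - 1) : ℕ) := by exact_mod_cast hmain
    push_cast at this ⊢
    linarith
  have hpow := hfree.card_pow_le hj (by positivity) hbias
  have hpow' : A.card ^ (j + 2) ≤ (3 * p ^ (n - 1)) ^ j * (p ^ n * A.card) := by
    exact_mod_cast hpow
  obtain ⟨d, rfl⟩ : ∃ d, n = d + 1 := ⟨n - 1, by omega⟩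
  rw [Nat.add_sub_cancel] at *
  set κ := p ^ d
  have hA : 0 < A.card := lt_of_lt_of_le (Nat.mul_pos (by omega) hκ) hcard
  have h9 : 9 * κ ≤ A.card := le_trans (by gcongr; omega) hcard
  have h1 : (3 * κ) ^ j * A.card * κ * (3 ^ j * m) ≤ (3 * κ) ^ j * A.card * κ * p :=
    calc (3 * κ) ^ j * A.card * κ * (3 ^ j * m) = (9 * κ) ^ j * (m * κ) * A.card := by
          rw [show 9 * κ = 3 * (3 * κ) by ring, mul_pow 3 (3 * κ)]
          ring
      _ ≤ A.card ^ j * A.card * A.card := by gcongr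
      _ = A.card ^ (j + 2) := by ring
      _ ≤ (3 * κ) ^ j * (p ^ (d + 1) * A.card) := hpow'
      _ = (3 * κ) ^ j * A.card * κ * p := by rw [pow_succ]; ring
  have h2 : 3 ^ j * m ≤ p := le_of_mul_le_mul_left h1 (by positivity)
  have h3 : j + 4 ≤ 3 ^ j := by
    have hj2 : 2 ≤ j := by omega
    clear * - hj2
    induction j, hj2 using Nat.le_induction with
    | base => norm_num
    | succ j _ ih => rw [pow_succ]; omega
  nlinarith [Nat.mul_le_mul_right m h3]
end
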